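/- arXiv:1904.00563 — 2 statements merged into one kernel-verified Lean document; each statement's English description precedes it below -/
import Mathlib

section
/- Every simple bipartite planar graph with minimum degree at least 3 has proper orientation number at most 3, i.e., admits a proper orientation in which every vertex has indegree at most 3. -/
/-- An orientation of a simple graph: a relation choosing exactly one
direction for each edge, and nothing else. -/
def IsOrientation {V : Type*} (G : SimpleGraph V) (o : V → V → Prop) : Prop :=
  (∀ u v, G.Adj u v ↔ (o u v ∨ o v u)) ∧ (∀ u v, o u v → ¬ o v u)

/-- Indegree of a vertex in an orientation. -/
noncomputable def inDeg {V : Type*} (o : V → V → Prop) (v : V) : ℕ :=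
  {u | o u v}.ncard

/-- A proper orientation: adjacent vertices get distinct indegrees. -/
def IsProper {V : Type*} (G : SimpleGraph V) (o : V → V → Prop) : Prop :=
  ∀ u v, G.Adj u v → inDeg o u ≠ inDeg o v

/-- A graph is bipartite iff it admits a proper 2-coloring. -/
def IsBipartite {V : Type*} (G : SimpleGraph V) : Prop :=
  ∃ c : V → Bool, ∀ u v, G.Adj u v → c u ≠ c v

/-- A drawing of `G` in the plane: vertices are distinct points, each edge is a
simple arc between the images of its endpoints, arcs pass through no other
vertex points, arcs of distinct edges meet only in common endpoints, and the
two directions of an edge trace the same arc. -/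
structure PlaneDrawing {V : Type*} (G : SimpleGraph V) where
  vert : V → ℝ × ℝ
  vert_inj : Function.Injective vert
  arc : ∀ ⦃u v : V⦄, G.Adj u v → Path (vert u) (vert v)
  arc_inj : ∀ ⦃u v : V⦄ (h : G.Adj u v), Function.Injective (arc h)
  arc_symm : ∀ ⦃u v : V⦄ (h : G.Adj u v), Set.range ⇑(arc h.symm) = Set.range ⇑(arc h)
  arc_vert : ∀ ⦃u v : V⦄ (h : G.Adj u v) (w : V),
    vert w ∈ Set.range ⇑(arc h) → w = u ∨ w = v
  arc_disjoint : ∀ ⦃u v u' v' : V⦄ (h : G.Adj u v) (h' : G.Adj u' v'),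
    s(u, v) ≠ s(u', v') →
    Set.range ⇑(arc h) ∩ Set.range ⇑(arc h') ⊆
      ({vert u, vert v} : Set (ℝ × ℝ)) ∩ {vert u', vert v'}

/-- A graph is planar iff it admits a plane drawing. -/
def IsPlanar {V : Type*} (G : SimpleGraph V) : Prop :=
  Nonempty (PlaneDrawing G)


namespace GridPlanar

/-- Grid edges: `(true, i, j)` is horizontal from `(i,j)`, `(false, i, j)` is vertical. -/
abbrev GE := Bool × ℤ × ℤ

def p0 (γ : GE) : ℤ × ℤ := γ.2
def p1 (γ : GE) : ℤ × ℤ := if γ.1 then (γ.2.1 + 1, γ.2.2) else (γ.2.1, γ.2.2 + 1)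
/-- the two squares beside a grid edge -/
def q0 (γ : GE) : ℤ × ℤ := γ.2
def q1 (γ : GE) : ℤ × ℤ := if γ.1 then (γ.2.1, γ.2.2 - 1) else (γ.2.1 - 1, γ.2.2)

def GAdj (x y : ℤ × ℤ) : Prop :=
  ∃ γ : GE, (p0 γ = x ∧ p1 γ = y) ∨ (p0 γ = y ∧ p1 γ = x)

def RConn (r : ℤ × ℤ) (S : Set (ℤ × ℤ)) : Prop :=
  ∀ T : Set (ℤ × ℤ), r ∈ T → (∀ x ∈ S, x ∈ T → ∀ y ∈ S, GAdj x y → y ∈ T) → S ⊆ T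

noncomputable def bd : (GE →₀ ZMod 2) →ₗ[ZMod 2] ((ℤ × ℤ) →₀ ZMod 2) :=
  Finsupp.linearCombination (ZMod 2)
    (fun γ => Finsupp.single (p0 γ) 1 + Finsupp.single (p1 γ) 1)

lemma bd_single (γ : GE) (a : ZMod 2) :
    bd (Finsupp.single γ a) = a • (Finsupp.single (p0 γ) 1 + Finsupp.single (p1 γ) 1) := by
  simp [bd]

lemma bd_apply (y : GE →₀ ZMod 2) (i j : ℤ) :
    bd y (i, j) = y (true, i, j) + y (true, i - 1, j) + y (false, i, j) + y (false, i, j - 1) := by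
  induction y using Finsupp.induction_linear with
  | zero => simp
  | add f g hf hg => rw [map_add, Finsupp.add_apply, hf, hg]; simp only [Finsupp.add_apply]; ring
  | single γ a =>
    obtain ⟨b, k, l⟩ := γ
    rw [bd_single]
    simp only [Finsupp.smul_apply, Finsupp.add_apply, Finsupp.single_apply, smul_eq_mul, p0, p1]
    cases b
    · have h1 : ((k, l + 1) = (i, j)) ↔ (k = i ∧ l = j - 1) := by
        simp only [Prod.mk.injEq]; omega
      simp [h1, mul_add]
    · have h1 : ((k + 1, l) = (i, j)) ↔ (k = i - 1 ∧ l = j) := by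
        simp only [Prod.mk.injEq]; omega
      simp [h1, mul_add]

lemma two_self (a : ZMod 2) : a + a = 0 := CharTwo.add_self_eq_zero a

lemma fin_self {α : Type*} (a : α →₀ ZMod 2) : a + a = 0 := by
  ext x; simp [two_self]

lemma exists_height (y : GE →₀ ZMod 2) (hy : bd y = 0) :
    ∃ w : ℤ × ℤ → ZMod 2, ∀ γ, y γ = w (q0 γ) + w (q1 γ) := by
  obtain ⟨m, hm⟩ : ∃ m : ℤ, ∀ b i j, i ≤ m → y (b, i, j) = 0 := by
    obtain ⟨m, hm⟩ := (y.support.image (fun γ => γ.2.1)).bddBelow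
    refine ⟨m - 1, fun b i j hi => ?_⟩
    by_contra h
    have : m ≤ i := hm (by
      simp only [Finset.coe_image, Set.mem_image]
      exact ⟨(b, i, j), by simpa using h, rfl⟩)
    omega
  let w : ℤ × ℤ → ZMod 2 := fun z => ∑ k ∈ Finset.Ioc m z.1, y (false, k, z.2)
  have hv : ∀ i j, w (i, j) = y (false, i, j) + w (i - 1, j) := by
    intro i j
    by_cases hi : i ≤ m
    · simp only [w]
      rw [Finset.Ioc_eq_empty (by omega), Finset.Ioc_eq_empty (by omega), hm _ _ _ hi]; simp
    · have : Finset.Ioc m i = insert i (Finset.Ioc m (i - 1)) := by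
        ext k; simp only [Finset.mem_Ioc, Finset.mem_insert]; omega
      simp only [w]
      rw [this, Finset.sum_insert (by simp)]
  have hrel : ∀ i j, y (true, i, j) + y (true, i - 1, j) + y (false, i, j)
      + y (false, i, j - 1) = 0 := by
    intro i j; rw [← bd_apply, hy]; rfl
  have hlow : ∀ i j, i ≤ m → w (i, j) = 0 := by
    intro i j hi
    simp only [w]; rw [Finset.Ioc_eq_empty (by omega)]; simp
  have hh : ∀ j i, m ≤ i → y (true, i, j) = w (i, j) + w (i, j - 1) := by
    intro j i hi
    induction i, hi using Int.leInduction with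
    | base => rw [hm _ _ _ le_rfl, hlow _ _ le_rfl, hlow _ _ le_rfl]; simp
    | succ n hn ih =>
      have h1 := hrel (n + 1) j
      rw [hv (n + 1) j, hv (n + 1) (j - 1)]
      simp only [add_sub_cancel_right] at h1 ⊢
      rw [ih] at h1
      linear_combination h1 - two_self (w (n, j)) - two_self (w (n, j-1)) -
        two_self (y (false, n+1, j)) - two_self (y (false, n+1, j-1))
  refine ⟨w, ?_⟩
  rintro ⟨b, i, j⟩
  cases b
  · simp only [q0, q1]
    have := hv i j
    simp only [Bool.false_eq_true, if_false]
    linear_combination - this - two_self (w (i-1, j))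
  · simp only [q0, q1, if_true]
    by_cases hi : m ≤ i
    · exact hh j i hi
    · rw [hm _ _ _ (by omega), hlow _ _ (by omega), hlow _ _ (by omega)]; simp

lemma rconn_chain {r : ℤ × ℤ} {S : Set (ℤ × ℤ)} (h : RConn r S) (x : ℤ × ℤ) (hx : x ∈ S) :
    ∃ y : GE →₀ ZMod 2, (∀ γ, y γ ≠ 0 → p0 γ ∈ S ∧ p1 γ ∈ S) ∧
      bd y = Finsupp.single x 1 + Finsupp.single r 1 := by
  refine h {x | ∃ y : GE →₀ ZMod 2, (∀ γ, y γ ≠ 0 → p0 γ ∈ S ∧ p1 γ ∈ S) ∧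
      bd y = Finsupp.single x 1 + Finsupp.single r 1} ?_ ?_ hx
  · exact ⟨0, by simp, by rw [map_zero]; exact (fin_self _).symm⟩
  · rintro x hx ⟨y, hy, hb⟩ x' hx' ⟨γ, hγ⟩
    have hin : p0 γ ∈ S ∧ p1 γ ∈ S := by
      rcases hγ with ⟨rfl, rfl⟩ | ⟨rfl, rfl⟩ <;> exact ⟨by assumption, by assumption⟩
    have hsum : (Finsupp.single (p0 γ) 1 + Finsupp.single (p1 γ) 1 : (ℤ × ℤ) →₀ ZMod 2)
        = Finsupp.single x 1 + Finsupp.single x' 1 := by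
      rcases hγ with ⟨rfl, rfl⟩ | ⟨rfl, rfl⟩
      · rfl
      · rw [add_comm]
    refine ⟨y + Finsupp.single γ 1, ?_, ?_⟩
    · intro γ' h'
      by_cases hg : γ = γ'
      · subst hg; exact hin
      · apply hy
        simpa [Finsupp.single_apply, hg] using h'
    · rw [map_add, hb, bd_single, one_smul, hsum]
      have := fin_self (Finsupp.single x (1 : ZMod 2))
      rw [show ∀ a b c : (ℤ × ℤ) →₀ ZMod 2, a + b + (a + c) = (a + a) + (c + b) by
        intros; abel]
      rw [this, zero_add]

/-- MacLane style count. -/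
theorem maclane_count {V E Q : Type*} [Fintype V] [Fintype E]
    (s t : E → V)
    (hinj : ∀ e e', s e = s e' → t e = t e' → e = e')
    (f g : E → Q) (b : Q → E → ZMod 2)
    (hb : ∀ q e, b q e ≠ 0 → f e = q ∨ g e = q)
    (δ : (E → ZMod 2) →ₗ[ZMod 2] (V → ZMod 2))
    (hδs : ∀ c e, δ c (s e) = 0 → c e ≠ 0 → ∃ e', e' ≠ e ∧ s e' = s e ∧ c e' ≠ 0)
    (hδt : ∀ c e, δ c (t e) = 0 → c e ≠ 0 → ∃ e', e' ≠ e ∧ t e' = t e ∧ c e' ≠ 0)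
    (hbk : ∀ q, δ (b q) = 0)
    (hspan : ∀ c, δ c = 0 → ∃ w : Q → ZMod 2, ∀ S : Finset Q, (∀ e, f e ∈ S ∧ g e ∈ S) →
      c = ∑ q ∈ S, w q • b q) :
    Fintype.card E ≤ 2 * Fintype.card V := by
  classical
  let Φ : Finset Q := Finset.univ.image f ∪ Finset.univ.image g
  have hΦ : ∀ e, f e ∈ Φ ∧ g e ∈ Φ := fun e => by simp [Φ]
  let Φ' := Φ.filter (fun q => b q ≠ 0)
  -- dimension
  have h1 : Module.finrank (ZMod 2) (LinearMap.ker δ) ≤ Φ'.card := by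
    have hle : LinearMap.ker δ ≤ Submodule.span (ZMod 2) ((Φ'.image b : Finset _) : Set (E → ZMod 2)) := by
      intro c hc
      obtain ⟨w, hw⟩ := hspan c hc
      rw [hw Φ hΦ]
      refine Submodule.sum_mem _ fun q hq => ?_
      by_cases hz : b q = 0
      · rw [hz, smul_zero]; exact Submodule.zero_mem _
      · refine Submodule.smul_mem _ _ (Submodule.subset_span ?_)
        rw [Finset.coe_image]
        exact ⟨q, by simp [Φ', hq, hz], rfl⟩
    refine (Submodule.finrank_mono hle).trans ((finrank_span_finset_le_card _).trans Finset.card_image_le)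
  have h2 : Fintype.card E ≤ Fintype.card V + Module.finrank (ZMod 2) (LinearMap.ker δ) := by
    have := LinearMap.finrank_range_add_finrank_ker δ
    have h3 := Submodule.finrank_le (LinearMap.range δ)
    simp only [Module.finrank_fintype_fun_eq_card] at this h3
    omega
  have h4 : ∀ q ∈ Φ', 4 ≤ (Finset.univ.filter (fun e => b q e ≠ 0)).card := by
    intro q hq
    have hq0 : b q ≠ 0 := (Finset.mem_filter.1 hq).2
    obtain ⟨e, he⟩ := Function.ne_iff.1 hq0
    have k : ∀ v, δ (b q) v = 0 := fun v => by rw [hbk]; rfl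
    obtain ⟨e1, n1, s1, c1⟩ := hδs _ e (k _) he
    obtain ⟨e2, n2, t2, c2⟩ := hδt _ e (k _) he
    obtain ⟨e3, n3, t3, c3⟩ := hδt _ e1 (k _) c1
    have hsub : ({e, e1, e2, e3} : Finset E) ⊆ Finset.univ.filter (fun e => b q e ≠ 0) := by
      intro x hx
      simp only [Finset.mem_insert, Finset.mem_singleton] at hx
      simp only [Finset.mem_filter, Finset.mem_univ, true_and]
      rcases hx with rfl | rfl | rfl | rfl <;> assumption
    have ht1 : t e ≠ t e1 := fun h => n1 (hinj _ _ s1 h.symm)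
    have hcard : ({e, e1, e2, e3} : Finset E).card = 4 := by
      have a1 : e ≠ e1 := n1.symm
      have a2 : e ≠ e2 := n2.symm
      have a3 : e ≠ e3 := fun h => ht1 (by rw [← t3, ← h])
      have a4 : e1 ≠ e2 := fun h => ht1 (by rw [h, t2])
      have a5 : e1 ≠ e3 := n3.symm
      have a6 : e2 ≠ e3 := fun h => ht1 (by rw [← t2, h, t3])
      rw [Finset.card_insert_of_notMem (by simp [*]), Finset.card_insert_of_notMem (by simp [*]),
        Finset.card_insert_of_notMem (by simp [*]), Finset.card_singleton]
    rw [← hcard]; exact Finset.card_le_card hsub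
  have h5 : 4 * Φ'.card ≤ 2 * Fintype.card E := by
    calc 4 * Φ'.card = ∑ q ∈ Φ', 4 := by simp [mul_comm]
      _ ≤ ∑ q ∈ Φ', (Finset.univ.filter (fun e => b q e ≠ 0)).card := Finset.sum_le_sum h4
      _ = ∑ e : E, (Φ'.filter (fun q => b q e ≠ 0)).card :=
        Finset.sum_card_bipartiteAbove_eq_sum_card_bipartiteBelow (fun q e => b q e ≠ 0)
      _ ≤ ∑ e : E, 2 := by
        refine Finset.sum_le_sum fun e _ => ?_
        refine le_trans (Finset.card_le_card (t := {f e, g e}) ?_) Finset.card_le_two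
        intro q hq
        have := hb q e (Finset.mem_filter.1 hq).2
        simp only [Finset.mem_insert, Finset.mem_singleton]
        tauto
      _ = 2 * Fintype.card E := by simp [mul_comm]
  omega

theorem grid_count {V E : Type*} [Fintype V] [Fintype E]
    (s t : E → V) (col : V → Bool) (hs : ∀ e, col (s e) = true) (ht : ∀ e, col (t e) = false)
    (hinj : ∀ e e', s e = s e' → t e = t e' → e = e')
    (B : V → Set (ℤ × ℤ)) (root : V → ℤ × ℤ) (hfin : ∀ v, (B v).Finite)
    (hconn : ∀ v, RConn (root v) (B v))
    (hdisj : ∀ u v x, x ∈ B u → x ∈ B v → u = v)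
    (hadj : ∀ e, ∃ x ∈ B (s e), ∃ y ∈ B (t e), GAdj x y) :
    Fintype.card E ≤ 2 * Fintype.card V := by
  classical
  choose x hx y hy ε hε using hadj
  have hst : ∀ e e', s e ≠ t e' := fun e e' h => by
    have := hs e; rw [h, ht] at this; cases this
  have hends : ∀ e, (p0 (ε e) ∈ B (s e) ∧ p1 (ε e) ∈ B (t e)) ∨
      (p0 (ε e) ∈ B (t e) ∧ p1 (ε e) ∈ B (s e)) := by
    intro e
    rcases hε e with ⟨h1, h2⟩ | ⟨h1, h2⟩
    · left; rw [h1, h2]; exact ⟨hx e, hy e⟩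
    · right; rw [h1, h2]; exact ⟨hy e, hx e⟩
  let Inside : GE → Prop := fun γ => ∃ v, p0 γ ∈ B v ∧ p1 γ ∈ B v
  have hεin : ∀ e, ¬ Inside (ε e) := by
    rintro e ⟨v, h0, h1⟩
    rcases hends e with ⟨a, b⟩ | ⟨a, b⟩
    · exact hst e e ((hdisj _ _ _ a h0).trans (hdisj _ _ _ b h1).symm)
    · exact hst e e ((hdisj _ _ _ b h1).trans (hdisj _ _ _ a h0).symm)
  have hεinj : Function.Injective ε := by
    intro e e' h
    rcases hends e with ⟨a, b⟩ | ⟨a, b⟩ <;> rcases hends e' with ⟨a', b'⟩ | ⟨a', b'⟩ <;>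
      rw [← h] at a' b'
    · exact hinj _ _ (hdisj _ _ _ a a') (hdisj _ _ _ b b')
    · exact absurd (hdisj _ _ _ a a') (hst _ _)
    · exact absurd (hdisj _ _ _ a' a) (hst _ _)
    · exact hinj _ _ (hdisj _ _ _ b b') (hdisj _ _ _ a a')
  let H : GE → Prop := fun γ => Inside γ ∨ ∃ e, ε e = γ
  have hHfin : {γ | H γ}.Finite := by
    refine ((Set.finite_iUnion fun v => ((Set.finite_univ (α := Bool)).prod (hfin v))).union
      (Set.finite_range ε)).subset ?_
    rintro γ (⟨v, h0, h1⟩ | ⟨e, rfl⟩)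
    · left; exact Set.mem_iUnion.2 ⟨v, Set.mem_univ _, h0⟩
    · right; exact ⟨e, rfl⟩
  let R : ℤ × ℤ → ℤ × ℤ → Prop := fun a b => ∃ γ, ¬ H γ ∧ q0 γ = a ∧ q1 γ = b
  let f : E → Quot R := fun e => Quot.mk R (q0 (ε e))
  let g : E → Quot R := fun e => Quot.mk R (q1 (ε e))
  let b : Quot R → E → ZMod 2 := fun q e =>
    (if f e = q then 1 else 0) + (if g e = q then 1 else 0)
  let M : Matrix V E (ZMod 2) := fun v e => (if s e = v then 1 else 0) + (if t e = v then 1 else 0)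
  have hM : ∀ c v, M.mulVecLin c v = ∑ e, M v e * c e := fun c v => rfl
  refine maclane_count s t hinj f g b ?_ M.mulVecLin ?_ ?_ ?_ ?_
  · intro q e h
    by_contra! hcon
    exact h (by simp [b, hcon.1, hcon.2])
  · intro c e h0 hc
    by_contra! hcon
    rw [hM, Finset.sum_eq_single e] at h0
    · simp [M, (hst e e).symm] at h0; exact hc h0
    · intro e' _ hne
      by_cases hse : s e' = s e
      · rw [hcon e' hne hse, mul_zero]
      · simp [M, hse, (hst e e').symm]
    · simp
  · intro c e h0 hc
    by_contra! hcon
    rw [hM, Finset.sum_eq_single e] at h0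
    · simp [M, (hst e e)] at h0; exact hc h0
    · intro e' _ hne
      by_cases hse : t e' = t e
      · rw [hcon e' hne hse, mul_zero]
      · simp [M, hse, (hst e' e)]
    · simp
  · intro q
    let w : ℤ × ℤ → ZMod 2 := fun z => if Quot.mk R z = q then 1 else 0
    let d : GE → ZMod 2 := fun γ => w (q0 γ) + w (q1 γ)
    have hd : ∀ γ, d γ ≠ 0 → γ ∈ hHfin.toFinset := by
      intro γ h
      rw [Set.Finite.mem_toFinset]
      by_contra hH
      apply h
      have : Quot.mk R (q0 γ) = Quot.mk R (q1 γ) := Quot.sound ⟨γ, hH, rfl, rfl⟩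
      simp only [d, w, this]
      exact two_self _
    let Y : GE →₀ ZMod 2 := Finsupp.onFinset hHfin.toFinset d hd
    have hYd : ∀ γ, Y γ = d γ := fun γ => rfl
    have hY : bd Y = 0 := by
      ext ⟨i, j⟩
      rw [bd_apply]
      simp only [hYd, d, q0, q1, Finsupp.zero_apply, Bool.false_eq_true, if_false, if_true]
      linear_combination two_self (w (i, j)) + two_self (w (i - 1, j)) + two_self (w (i, j - 1))
        + two_self (w (i - 1, j - 1))
    have hYs : Y = ∑ γ ∈ hHfin.toFinset, Finsupp.single γ (d γ) := by
      ext γ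
      rw [Finsupp.finsetSum_apply, hYd]
      simp only [Finsupp.single_apply]
      rw [Finset.sum_ite_eq']
      split_ifs with h
      · rfl
      · by_contra h'; exact h (hd _ h')
    ext v
    let χ : ((ℤ × ℤ) →₀ ZMod 2) →ₗ[ZMod 2] ZMod 2 :=
      Finsupp.linearCombination (ZMod 2) (fun z => if z ∈ B v then (1 : ZMod 2) else 0)
    have hχ : ∀ γ a, χ (bd (Finsupp.single γ a)) =
        a * ((if p0 γ ∈ B v then 1 else 0) + (if p1 γ ∈ B v then 1 else 0)) := by
      intro γ a
      rw [bd_single]; simp [χ, mul_add]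
    have hmem : ∀ u z, z ∈ B u → (if z ∈ B v then (1 : ZMod 2) else 0) = if u = v then 1 else 0 := by
      intro u z hz
      by_cases huv : u = v
      · subst huv; simp [hz]
      · rw [if_neg huv, if_neg (fun h => huv (hdisj _ _ _ hz h))]
    have h0 : χ (bd Y) = 0 := by rw [hY, map_zero]
    rw [hYs, map_sum, map_sum] at h0
    simp only [hχ] at h0
    have hsub : Finset.univ.image ε ⊆ hHfin.toFinset := by
      intro γ hγ
      obtain ⟨e, -, rfl⟩ := Finset.mem_image.1 hγ
      rw [Set.Finite.mem_toFinset]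
      exact Or.inr ⟨e, rfl⟩
    rw [← Finset.sum_subset hsub, Finset.sum_image (fun a _ b _ h => hεinj h)] at h0
    · rw [hM, Pi.zero_apply, ← h0]
      refine Finset.sum_congr rfl fun e _ => ?_
      have hMe : M v e = (if p0 (ε e) ∈ B v then 1 else 0) + (if p1 (ε e) ∈ B v then 1 else 0) := by
        rcases hends e with ⟨h1, h2⟩ | ⟨h1, h2⟩
        · rw [hmem _ _ h1, hmem _ _ h2]
        · rw [hmem _ _ h1, hmem _ _ h2, add_comm]
      rw [hMe, mul_comm]
    · intro γ hγ hne
      rw [Set.Finite.mem_toFinset] at hγ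
      rcases hγ with ⟨u, h1, h2⟩ | ⟨e, rfl⟩
      · rw [hmem _ _ h1, hmem _ _ h2, two_self, mul_zero]
      · exact absurd (Finset.mem_image_of_mem _ (Finset.mem_univ _)) hne
  · intro c hc
    choose jx hjx hbx using fun e => rconn_chain (hconn (s e)) (x e) (hx e)
    choose jy hjy hby using fun e => rconn_chain (hconn (t e)) (y e) (hy e)
    have hin0x : ∀ e γ, ¬ Inside γ → jx e γ = 0 := by
      intro e γ h
      by_contra h'; exact h ⟨_, hjx e γ h'⟩
    have hin0y : ∀ e γ, ¬ Inside γ → jy e γ = 0 := by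
      intro e γ h
      by_contra h'; exact h ⟨_, hjy e γ h'⟩
    let C : GE →₀ ZMod 2 := ∑ e, c e • (Finsupp.single (ε e) 1 + jx e + jy e)
    have hCin : ∀ γ, ¬ Inside γ → C γ = ∑ e, c e * (if ε e = γ then 1 else 0) := by
      intro γ h
      simp only [C, Finsupp.finsetSum_apply, Finsupp.smul_apply, Finsupp.add_apply,
        hin0x _ γ h, hin0y _ γ h, Finsupp.single_apply, add_zero, smul_eq_mul]
    have hCε : ∀ e, C (ε e) = c e := by
      intro e
      rw [hCin _ (hεin e)]
      simp [hεinj.eq_iff]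
    have hCH : ∀ γ, ¬ H γ → C γ = 0 := by
      intro γ h
      rw [hCin _ (fun h' => h (Or.inl h'))]
      refine Finset.sum_eq_zero fun e _ => ?_
      rw [if_neg (fun h' => h (Or.inr ⟨e, h'⟩)), mul_zero]
    have hbe : ∀ e, bd (Finsupp.single (ε e) 1 + jx e + jy e) =
        Finsupp.single (root (s e)) 1 + Finsupp.single (root (t e)) 1 := by
      intro e
      have h1 : (Finsupp.single (p0 (ε e)) 1 + Finsupp.single (p1 (ε e)) 1 : (ℤ × ℤ) →₀ ZMod 2)
          = Finsupp.single (x e) 1 + Finsupp.single (y e) 1 := by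
        rcases hε e with ⟨h1, h2⟩ | ⟨h1, h2⟩
        · rw [h1, h2]
        · rw [h1, h2, add_comm]
      rw [map_add, map_add, hbx, hby, bd_single, one_smul, h1]
      rw [show ∀ a b r r' : (ℤ × ℤ) →₀ ZMod 2,
        a + b + (a + r) + (b + r') = (a + a) + (b + b) + (r + r') by intros; abel]
      rw [fin_self, fin_self, zero_add, zero_add]
    have hbC : bd C = 0 := by
      have h1 : ∑ v, (M.mulVecLin c v) • (Finsupp.single (root v) 1 : (ℤ × ℤ) →₀ ZMod 2) = 0 := by
        rw [hc]; simp
      rw [← h1]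
      simp only [C, map_sum, map_smul, hbe, hM, Finset.sum_smul]
      rw [Finset.sum_comm]
      refine Finset.sum_congr rfl fun e _ => ?_
      simp only [M, add_mul, add_smul, Finset.sum_add_distrib, ite_mul, one_mul, zero_mul,
        ite_smul, zero_smul, Finset.sum_ite_eq, Finset.mem_univ, if_true, smul_add]
    obtain ⟨w, hw⟩ := exists_height C hbC
    have hwR : ∀ a b, R a b → w a = w b := by
      rintro _ _ ⟨γ, hγ, rfl, rfl⟩
      have := hw γ
      rw [hCH γ hγ] at this
      linear_combination -this - two_self (w (q1 γ))
    refine ⟨Quot.lift w hwR, fun S hS => ?_⟩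
    ext e
    rw [← hCε e, hw, Finset.sum_apply]
    simp only [Pi.smul_apply, smul_eq_mul, b, mul_add, mul_ite, mul_one, mul_zero,
      Finset.sum_add_distrib, Finset.sum_ite_eq, (hS e).1, (hS e).2, if_true]
    rfl

/-- grid points close to the set `K` at scale `h` -/
def gp (h : ℝ) (z : ℤ × ℤ) : ℝ × ℝ := (h * z.1, h * z.2)

def NB (h : ℝ) (K : Set (ℝ × ℝ)) : Set (ℤ × ℤ) := {z | ∃ p ∈ K, dist (gp h z) p < h}

lemma NB_mono {h : ℝ} {K L : Set (ℝ × ℝ)} (hKL : K ⊆ L) : NB h K ⊆ NB h L :=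
  fun _ ⟨p, hp, hd⟩ => ⟨p, hKL hp, hd⟩

lemma exists_gp {h : ℝ} (hh : 0 < h) (p : ℝ × ℝ) : ∃ z, dist (gp h z) p < h := by
  have key : ∀ a : ℝ, dist (h * (⌊a / h⌋ : ℝ)) a < h := by
    intro a
    have h1 := Int.floor_le (a / h)
    have h2 := Int.lt_floor_add_one (a / h)
    rw [le_div_iff₀ hh] at h1
    rw [div_lt_iff₀ hh] at h2
    rw [Real.dist_eq, abs_lt]
    constructor <;> nlinarith
  refine ⟨(⌊p.1 / h⌋, ⌊p.2 / h⌋), ?_⟩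
  rw [Prod.dist_eq]
  exact max_lt (key _) (key _)

lemma adj_h (i j : ℤ) : GAdj (i, j) (i + 1, j) := ⟨(true, i, j), Or.inl ⟨rfl, by simp [p1]⟩⟩
lemma adj_v (i j : ℤ) : GAdj (i, j) (i, j + 1) := ⟨(false, i, j), Or.inl ⟨rfl, by simp [p1]⟩⟩
lemma adj_symm {x y : ℤ × ℤ} (h : GAdj x y) : GAdj y x := by
  obtain ⟨γ, h⟩ := h; exact ⟨γ, h.symm⟩

lemma int_close {h : ℝ} (hh : 0 < h) {a b : ℤ} {p : ℝ} (h1 : dist (h * (a : ℝ)) p < h)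
    (h2 : dist (h * (b : ℝ)) p < h) : a = b ∨ b = a + 1 ∨ a = b + 1 := by
  rw [Real.dist_eq, abs_lt] at h1 h2
  have h3 : (a : ℝ) < b + 2 := by nlinarith
  have h4 : (b : ℝ) < a + 2 := by nlinarith
  have h3' : a < b + 2 := by exact_mod_cast h3
  have h4' : b < a + 2 := by exact_mod_cast h4
  omega

lemma NB_rconn {h : ℝ} (hh : 0 < h) {K : Set (ℝ × ℝ)} (hK : IsPreconnected K)
    {r : ℤ × ℤ} (hr : r ∈ NB h K) : RConn r (NB h K) := by
  intro T hrT hT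
  have local_conn : ∀ p ∈ K, ∀ z z', dist (gp h z) p < h → dist (gp h z') p < h → z ∈ T → z' ∈ T := by
    rintro p hp ⟨a, b⟩ ⟨a', b'⟩ hz hz' hzT
    have hz1 := hz
    have hz1' := hz'
    rw [Prod.dist_eq, max_lt_iff] at hz hz'
    simp only [gp] at hz hz'
    have hm : dist (gp h (a', b)) p < h := by
      rw [Prod.dist_eq, max_lt_iff]; exact ⟨hz'.1, hz.2⟩
    have hmT : (a', b) ∈ T := by
      rcases int_close hh hz.1 hz'.1 with e | e | e
      · subst e; exact hzT
      · subst e; exact hT _ ⟨p, hp, hz1⟩ hzT _ ⟨p, hp, hm⟩ (adj_h _ _)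
      · subst e; exact hT _ ⟨p, hp, hz1⟩ hzT _ ⟨p, hp, hm⟩ (adj_symm (adj_h _ _))
    rcases int_close hh hz.2 hz'.2 with e | e | e
    · subst e; exact hmT
    · subst e; exact hT _ ⟨p, hp, hm⟩ hmT _ ⟨p, hp, hz1'⟩ (adj_v _ _)
    · subst e; exact hT _ ⟨p, hp, hm⟩ hmT _ ⟨p, hp, hz1'⟩ (adj_symm (adj_v _ _))
  intro z hz
  by_contra hzT
  let U : Set (ℝ × ℝ) := ⋃ z ∈ T, Metric.ball (gp h z) h
  let U' : Set (ℝ × ℝ) := ⋃ z ∈ Tᶜ, Metric.ball (gp h z) h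
  have hU : IsOpen U := isOpen_biUnion fun _ _ => Metric.isOpen_ball
  have hU' : IsOpen U' := isOpen_biUnion fun _ _ => Metric.isOpen_ball
  have hmem : ∀ p z, dist (gp h z) p < h → z ∈ T → p ∈ U := fun p z hd hz =>
    Set.mem_biUnion hz (by rwa [Metric.mem_ball, dist_comm])
  have hmem' : ∀ p z, dist (gp h z) p < h → z ∉ T → p ∈ U' := fun p z hd hz =>
    Set.mem_biUnion (show z ∈ Tᶜ from hz) (by rwa [Metric.mem_ball, dist_comm])
  obtain ⟨p, hp, hd⟩ := hr
  obtain ⟨p', hp', hd'⟩ := hz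
  obtain ⟨c, hcK, hcU, hcU'⟩ := hK U U' hU hU' (by
    intro c _
    obtain ⟨z, hz⟩ := exists_gp hh c
    by_cases hzT : z ∈ T
    · exact Or.inl (hmem _ _ hz hzT)
    · exact Or.inr (hmem' _ _ hz hzT)) ⟨p, hp, hmem _ _ hd hrT⟩ ⟨p', hp', hmem' _ _ hd' hzT⟩
  simp only [U, Set.mem_iUnion, Metric.mem_ball, U'] at hcU hcU'
  obtain ⟨z1, h1, h1'⟩ := hcU
  obtain ⟨z2, h2, h2'⟩ := hcU'
  exact h2 (local_conn c hcK z1 z2 (by rwa [dist_comm]) (by rwa [dist_comm]) h1)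

lemma NB_finite {h : ℝ} (hh : 0 < h) {K : Set (ℝ × ℝ)} (hK : IsCompact K) : (NB h K).Finite := by
  obtain ⟨R, hR⟩ := hK.isBounded.subset_closedBall 0
  have key : ∀ (a : ℤ) (p : ℝ), dist (h * (a : ℝ)) p < h → dist p 0 ≤ R →
      a ∈ Set.Icc (-⌈R / h + 1⌉) ⌈R / h + 1⌉ := by
    intro a p h1 h2
    rw [Real.dist_eq, abs_lt] at h1
    rw [Real.dist_eq, sub_zero, abs_le] at h2
    have h3 := Int.le_ceil (R / h + 1)
    have h4 : R / h * h = R := div_mul_cancel₀ _ hh.ne'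
    have h5 : (a : ℝ) ≤ R / h + 1 := by
      by_contra! hc
      nlinarith
    have h6 : -(R / h + 1) ≤ (a : ℝ) := by
      by_contra! hc
      nlinarith
    constructor
    · have : -((⌈R / h + 1⌉ : ℤ) : ℝ) ≤ a := by linarith
      exact_mod_cast this
    · have : (a : ℝ) ≤ ((⌈R / h + 1⌉ : ℤ) : ℝ) := by linarith
      exact_mod_cast this
  refine ((Set.finite_Icc (-⌈R / h + 1⌉) ⌈R / h + 1⌉).prod
    (Set.finite_Icc (-⌈R / h + 1⌉) ⌈R / h + 1⌉)).subset ?_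
  rintro ⟨a, b⟩ ⟨p, hp, hd⟩
  have hp' := hR hp
  rw [Metric.mem_closedBall, Prod.dist_eq, max_le_iff] at hp'
  rw [Prod.dist_eq, max_lt_iff] at hd
  exact ⟨key a p.1 hd.1 hp'.1, key b p.2 hd.2 hp'.2⟩

open Filter Topology in
lemma NB_disjoint {K L : Set (ℝ × ℝ)} (hK : IsCompact K) (hL : IsCompact L) (hd : Disjoint K L) :
    ∀ᶠ h in 𝓝[>] (0 : ℝ), ∀ z, z ∈ NB h K → z ∉ NB h L := by
  obtain ⟨δ, hδ, hsep⟩ : ∃ δ > 0, ∀ p ∈ K, ∀ q ∈ L, δ ≤ dist p q := by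
    obtain ⟨r, hr, h⟩ := Metric.exists_pos_forall_lt_edist hK hL.isClosed hd
    refine ⟨r, hr, fun p hp q hq => ?_⟩
    have := h p hp q hq
    rw [edist_nndist] at this
    have h2 : r < nndist p q := by exact_mod_cast this
    exact le_of_lt (by exact_mod_cast h2)
  have : ∀ᶠ h in 𝓝[>] (0 : ℝ), h < δ / 2 :=
    nhdsWithin_le_nhds (gt_mem_nhds (by positivity))
  filter_upwards [this] with h hh z ⟨p, hp, h1⟩ ⟨q, hq, h2⟩
  have := hsep p hp q hq
  have := dist_triangle_left p q (gp h z)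
  linarith

open Filter Topology in
lemma ball_disjoint {K : Set (ℝ × ℝ)} (hK : IsCompact K) {p : ℝ × ℝ} (hp : p ∉ K) :
    ∀ᶠ r in 𝓝[>] (0 : ℝ), Disjoint (Metric.closedBall p r) K := by
  obtain ⟨ε, hε, h⟩ := Metric.isOpen_iff.1 hK.isClosed.isOpen_compl p hp
  have : ∀ᶠ r in 𝓝[>] (0 : ℝ), r < ε := nhdsWithin_le_nhds (gt_mem_nhds hε)
  filter_upwards [this] with r hr
  rw [Set.disjoint_left]
  intro x hx
  exact h (lt_of_le_of_lt hx hr)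

open Filter Topology in
lemma ball_ball_disjoint {p q : ℝ × ℝ} (hp : p ≠ q) :
    ∀ᶠ r in 𝓝[>] (0 : ℝ), Disjoint (Metric.closedBall p r) (Metric.closedBall q r) := by
  have h0 : 0 < dist p q := dist_pos.2 hp
  have : ∀ᶠ r in 𝓝[>] (0 : ℝ), r < dist p q / 2 :=
    nhdsWithin_le_nhds (gt_mem_nhds (by positivity))
  filter_upwards [this] with r hr
  exact Metric.closedBall_disjoint_closedBall (by linarith)

open Filter Topology in
theorem exists_blobs {V : Type*} [Fintype V] (G : SimpleGraph V) (D : PlaneDrawing G)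
    (c : V → Bool) :
    ∃ (B : V → Set (ℤ × ℤ)) (root : V → ℤ × ℤ), (∀ v, (B v).Finite) ∧
      (∀ v, RConn (root v) (B v)) ∧ (∀ u v x, x ∈ B u → x ∈ B v → u = v) ∧
      ∀ u v, G.Adj u v → c u = true → c v = false → ∃ x ∈ B u, ∃ y ∈ B v, GAdj x y := by
  classical
  let arcS : V → V → Set (ℝ × ℝ) := fun u v =>
    {p | ∃ h : G.Adj u v, p ∈ Set.range (D.arc h)}
  have arcS_eq : ∀ u v (h : G.Adj u v), arcS u v = Set.range (D.arc h) := by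
    intro u v h; ext p; exact ⟨fun ⟨_, hp⟩ => hp, fun hp => ⟨h, hp⟩⟩
  have arc_compact : ∀ u v, IsCompact (arcS u v) := by
    intro u v
    by_cases h : G.Adj u v
    · rw [arcS_eq u v h]; exact isCompact_range (D.arc h).continuous
    · have : arcS u v = ∅ := by ext p; exact ⟨fun ⟨h', _⟩ => (h h').elim, fun h => h.elim⟩
      rw [this]; exact isCompact_empty
  let L : V → Set (ℝ × ℝ) := fun u => {D.vert u} ∪ ⋃ v ∈ {v | c v = false}, arcS u v
  have L_compact : ∀ u, IsCompact (L u) := fun u =>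
    isCompact_singleton.union ((Set.toFinite _).isCompact_biUnion fun v _ => arc_compact u v)
  -- intersections of stars
  have L_inter : ∀ u u', c u = true → c u' = true → u ≠ u' → ∀ p, p ∈ L u → p ∈ L u' →
      ∃ v, c v = false ∧ p = D.vert v := by
    intro u u' hu hu' hne p hp hp'
    have nf : ∀ w, c w = true → c w = false → False := fun w h1 h2 => by
      rw [h1] at h2; cases h2
    rcases hp with hp | hp <;> rcases hp' with hp' | hp'
    · exact (hne (D.vert_inj ((Set.mem_singleton_iff.1 hp).symm.trans hp'))).elim
    · rw [Set.mem_singleton_iff] at hp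
      simp only [Set.mem_iUnion] at hp'
      obtain ⟨v, hv, h, hq⟩ := hp'
      rw [hp] at hq
      rcases D.arc_vert h u hq with e | e
      · exact (hne e).elim
      · subst e; exact (nf _ hu hv).elim
    · rw [Set.mem_singleton_iff] at hp'
      simp only [Set.mem_iUnion] at hp
      obtain ⟨v, hv, h, hq⟩ := hp
      rw [hp'] at hq
      rcases D.arc_vert h u' hq with e | e
      · exact (hne e.symm).elim
      · subst e; exact (nf _ hu' hv).elim
    · simp only [Set.mem_iUnion] at hp hp'
      obtain ⟨v, hv, h, hq⟩ := hp
      obtain ⟨v', hv', h', hq'⟩ := hp'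
      have hs : s(u, v) ≠ s(u', v') := by
        intro e
        rw [Sym2.eq_iff] at e
        rcases e with ⟨e, _⟩ | ⟨e, _⟩
        · exact hne e
        · subst e; exact nf _ hu hv'
      have h3 := D.arc_disjoint h h' hs ⟨hq, hq'⟩
      obtain ⟨h3, h4⟩ := h3
      rcases h3 with h3 | h3
      · rcases h4 with h4 | h4
        · exact (hne (D.vert_inj (h3.symm.trans h4))).elim
        · exact ⟨v', hv', h4⟩
      · exact ⟨v, hv, h3⟩
  -- choose the radius
  obtain ⟨r, ⟨⟨⟨hr1, hr2⟩, hr3⟩, hr0⟩⟩ : ∃ r : ℝ,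
      (((∀ v v', v ≠ v' → Disjoint (Metric.closedBall (D.vert v) r) (Metric.closedBall (D.vert v') r))
      ∧ (∀ v u, v ≠ u → Disjoint (Metric.closedBall (D.vert v) r) {D.vert u}))
      ∧ (∀ v u v', v ≠ u → v ≠ v' → Disjoint (Metric.closedBall (D.vert v) r) (arcS u v')))
      ∧ 0 < r := by
    refine Eventually.exists (f := 𝓝[>] (0 : ℝ)) ?_
    refine Eventually.and (Eventually.and (Eventually.and ?_ ?_) ?_) self_mem_nhdsWithin
    · refine eventually_all.2 fun v => eventually_all.2 fun v' => eventually_all.2 fun hne => ?_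
      exact ball_ball_disjoint fun e => hne (D.vert_inj e)
    · refine eventually_all.2 fun v => eventually_all.2 fun v' => eventually_all.2 fun hne => ?_
      exact ball_disjoint isCompact_singleton fun e => hne (D.vert_inj e)
    · refine eventually_all.2 fun v => eventually_all.2 fun u => eventually_all.2 fun v' =>
        eventually_all.2 fun hne => eventually_all.2 fun hne' => ?_
      refine ball_disjoint (arc_compact _ _) ?_
      rintro ⟨h, hq⟩
      rcases D.arc_vert h v hq with e | e
      · exact hne e
      · exact hne' e
  let Db : V → Set (ℝ × ℝ) := fun v => Metric.closedBall (D.vert v) r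
  have Db_compact : ∀ v, IsCompact (Db v) := fun v => isCompact_closedBall _ _
  let L' : V → Set (ℝ × ℝ) := fun u => L u \ ⋃ v ∈ {v | c v = false}, Metric.ball (D.vert v) r
  have L'_compact : ∀ u, IsCompact (L' u) := fun u =>
    (L_compact u).diff (isOpen_biUnion fun _ _ => Metric.isOpen_ball)
  -- choose the scale
  obtain ⟨h, ⟨⟨⟨⟨hh1, hh2⟩, hh3⟩, hh4⟩, hh0⟩⟩ : ∃ h : ℝ,
      ((((∀ v v', v ≠ v' → ∀ z, z ∈ NB h (Db v) → z ∉ NB h (Db v'))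
      ∧ (∀ v u, v ≠ u → ∀ z, z ∈ NB h (Db v) → z ∉ NB h {D.vert u}))
      ∧ (∀ v u v', v ≠ u → v ≠ v' → ∀ z, z ∈ NB h (Db v) → z ∉ NB h (arcS u v')))
      ∧ (∀ u u', c u = true → c u' = true → u ≠ u' → ∀ z, z ∈ NB h (L' u) → z ∉ NB h (L u')))
      ∧ 0 < h := by
    refine Eventually.exists (f := 𝓝[>] (0 : ℝ)) ?_
    refine Eventually.and (Eventually.and (Eventually.and (Eventually.and ?_ ?_) ?_) ?_)
      self_mem_nhdsWithin
    · exact eventually_all.2 fun v => eventually_all.2 fun v' => eventually_all.2 fun hne =>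
        NB_disjoint (Db_compact _) (Db_compact _) (hr1 _ _ hne)
    · exact eventually_all.2 fun v => eventually_all.2 fun v' => eventually_all.2 fun hne =>
        NB_disjoint (Db_compact _) isCompact_singleton (hr2 _ _ hne)
    · exact eventually_all.2 fun v => eventually_all.2 fun u => eventually_all.2 fun v' =>
        eventually_all.2 fun hne => eventually_all.2 fun hne' =>
        NB_disjoint (Db_compact _) (arc_compact _ _) (hr3 _ _ _ hne hne')
    · refine eventually_all.2 fun u => eventually_all.2 fun u' => eventually_all.2 fun hu =>
        eventually_all.2 fun hu' => eventually_all.2 fun hne =>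
        NB_disjoint (L'_compact _) (L_compact _) ?_
      rw [Set.disjoint_left]
      rintro p ⟨hp, hpb⟩ hp'
      obtain ⟨v, hv, rfl⟩ := L_inter u u' hu hu' hne p hp hp'
      exact hpb (Set.mem_biUnion (show v ∈ {v | c v = false} from hv) (Metric.mem_ball_self hr0))
  choose z0 hz0 using fun v => exists_gp hh0 (D.vert v)
  let X : V → Set (ℤ × ℤ) := fun u => {z | z ∈ NB h (L u) ∧ ∀ v, c v = false → z ∉ NB h (Db v)}
  let C : V → Set (ℤ × ℤ) := fun u =>
    {z | Relation.ReflTransGen (fun a b => GAdj a b ∧ b ∈ X u) (z0 u) z}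
  have hz0X : ∀ u, c u = true → z0 u ∈ X u := by
    intro u hu
    refine ⟨⟨D.vert u, Or.inl rfl, hz0 u⟩, fun v hv hz => ?_⟩
    have hne : v ≠ u := by rintro rfl; rw [hu] at hv; cases hv
    exact hh2 v u hne _ hz ⟨D.vert u, rfl, hz0 u⟩
  have hCX : ∀ u, c u = true → C u ⊆ X u := by
    intro u hu z hz
    rcases Relation.ReflTransGen.cases_tail hz with e | ⟨_, _, _, h⟩
    · rw [e]; exact hz0X u hu
    · exact h
  let B : V → Set (ℤ × ℤ) := fun v => if c v = true then C v else NB h (Db v)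
  have Bt : ∀ v, c v = true → B v = C v := fun v hv => if_pos hv
  have Bf : ∀ v, c v = false → B v = NB h (Db v) := fun v hv => if_neg (by simp [hv])
  have Btf : ∀ u v z, c u = true → c v = false → z ∈ B u → z ∈ B v → False := by
    intro u v z hu hv h1 h2
    rw [Bt u hu] at h1
    rw [Bf v hv] at h2
    exact (hCX u hu h1).2 v hv h2
  refine ⟨B, z0, ?_, ?_, ?_, ?_⟩
  · intro v
    rcases hv : c v with _ | _
    · rw [Bf v hv]; exact NB_finite hh0 (Db_compact v)
    · rw [Bt v hv]
      exact (NB_finite hh0 (L_compact v)).subset fun z hz => (hCX v hv hz).1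
  · intro v
    rcases hv : c v with _ | _
    · rw [Bf v hv]
      exact NB_rconn hh0 (convex_closedBall _ _).isPreconnected
        ⟨D.vert v, Metric.mem_closedBall_self hr0.le, hz0 v⟩
    · rw [Bt v hv]
      intro T hT hcl z hz
      induction hz with
      | refl => exact hT
      | tail hab hbc ih => exact hcl _ hab ih _ (hab.tail hbc) hbc.1
  · intro u v z hzu hzv
    by_contra hne
    rcases hu : c u with _ | _ <;> rcases hv : c v with _ | _
    · rw [Bf u hu] at hzu; rw [Bf v hv] at hzv
      exact hh1 u v hne z hzu hzv
    · exact Btf v u z hv hu hzv hzu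
    · exact Btf u v z hu hv hzu hzv
    · rw [Bt u hu] at hzu; rw [Bt v hv] at hzv
      obtain ⟨⟨p, hp, hd⟩, hn⟩ := hCX u hu hzu
      refine hh4 u v hu hv hne z ⟨p, ⟨hp, ?_⟩, hd⟩ (hCX v hv hzv).1
      intro hpb
      simp only [Set.mem_iUnion] at hpb
      obtain ⟨w, hw, hpw⟩ := hpb
      exact hn w hw ⟨p, Metric.ball_subset_closedBall hpw, hd⟩
  · intro u v huv hu hv
    rw [Bt u hu, Bf v hv]
    by_contra! hcon
    have harcL : arcS u v ⊆ L u := fun p hp =>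
      Or.inr (Set.mem_biUnion (show v ∈ {v | c v = false} from hv) hp)
    have hconn : IsPreconnected (arcS u v) := by
      rw [arcS_eq u v huv]; exact isPreconnected_range (D.arc huv).continuous
    have hu0 : z0 u ∈ NB h (arcS u v) :=
      ⟨D.vert u, by rw [arcS_eq u v huv]; exact ⟨0, (D.arc huv).source⟩, hz0 u⟩
    have hv0 : z0 v ∈ NB h (arcS u v) :=
      ⟨D.vert v, by rw [arcS_eq u v huv]; exact ⟨1, (D.arc huv).target⟩, hz0 v⟩
    have hsub := NB_rconn hh0 hconn hu0 (C u) Relation.ReflTransGen.refl (by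
      intro x hx hxC y hy hxy
      refine Relation.ReflTransGen.tail hxC ⟨hxy, NB_mono harcL hy, fun v' hv' hyv => ?_⟩
      by_cases e : v' = v
      · subst e; exact hcon x hxC y hyv hxy
      · have hne : v' ≠ u := by rintro rfl; rw [hu] at hv'; cases hv'
        exact hh3 v' u v hne e y hyv hy)
    exact (hCX u hu (hsub hv0)).2 v hv ⟨D.vert v, Metric.mem_closedBall_self hr0.le, hz0 v⟩

theorem edge_bound {V : Type*} [Fintype V] (G : SimpleGraph V) (D : PlaneDrawing G)
    (c : V → Bool) [DecidableEq V] (S : Finset (V × V))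
    (hS : ∀ e ∈ S, G.Adj e.1 e.2 ∧ c e.1 = true ∧ c e.2 = false) :
    S.card ≤ 2 * (S.biUnion fun e => {e.1, e.2}).card := by
  classical
  obtain ⟨B, root, hfin, hconn, hdisj, hadj⟩ := exists_blobs G D c
  have hm1 : ∀ e : S, e.1.1 ∈ S.biUnion fun e => {e.1, e.2} := fun e =>
    Finset.mem_biUnion.2 ⟨e.1, e.2, by simp⟩
  have hm2 : ∀ e : S, e.1.2 ∈ S.biUnion fun e => {e.1, e.2} := fun e =>
    Finset.mem_biUnion.2 ⟨e.1, e.2, by simp⟩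
  have := grid_count (V := ↥(S.biUnion fun e => {e.1, e.2})) (E := ↥S)
    (fun e => ⟨e.1.1, hm1 e⟩) (fun e => ⟨e.1.2, hm2 e⟩) (fun v => c v.1)
    (fun e => (hS e.1 e.2).2.1) (fun e => (hS e.1 e.2).2.2)
    (fun e e' h1 h2 => Subtype.ext (Prod.ext (congrArg Subtype.val h1) (congrArg Subtype.val h2)))
    (fun v => B v.1) (fun v => root v.1) (fun v => hfin v.1) (fun v => hconn v.1)
    (fun u v x hu hv => Subtype.ext (hdisj _ _ x hu hv))
    (fun e => hadj _ _ (hS e.1 e.2).1 (hS e.1 e.2).2.1 (hS e.1 e.2).2.2)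
  rwa [Fintype.card_coe, Fintype.card_coe] at this

end GridPlanar

/-- Every simple bipartite planar graph with minimum degree at least `3` has a
proper orientation with all indegrees at most `3`. -/
theorem bipartite_planar_proper_three_orientation {V : Type*} [Fintype V]
    (G : SimpleGraph V) (hbip : IsBipartite G) (hpl : IsPlanar G)
    (hdeg : ∀ v, 3 ≤ (G.neighborSet v).ncard) :
    ∃ o : V → V → Prop, IsOrientation G o ∧ IsProper G o ∧
      ∀ v, inDeg o v ≤ 3 := by
  classical
  obtain ⟨c, hc⟩ := hbip
  obtain ⟨D⟩ := hpl
  let E := {e : V × V // G.Adj e.1 e.2 ∧ c e.1 = true ∧ c e.2 = false}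
  -- Hall's theorem: assign every edge to one of its ends, each end used at most twice
  obtain ⟨m, hminj, hm⟩ : ∃ m : E → V × Fin 2, Function.Injective m ∧
      ∀ e, m e ∈ ({e.1.1, e.1.2} : Finset V) ×ˢ (Finset.univ : Finset (Fin 2)) := by
    refine (Finset.all_card_le_biUnion_card_iff_exists_injective
      (fun e : E => ({e.1.1, e.1.2} : Finset V) ×ˢ (Finset.univ : Finset (Fin 2)))).1 fun S => ?_
    have h1 := GridPlanar.edge_bound G D c (S.map (Function.Embedding.subtype _)) (by
      intro e he
      obtain ⟨e', _, rfl⟩ := Finset.mem_map.1 he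
      exact e'.2)
    rw [Finset.card_map] at h1
    have h2 : (S.biUnion fun e : E => ({e.1.1, e.1.2} : Finset V) ×ˢ (Finset.univ : Finset (Fin 2)))
        = ((S.map (Function.Embedding.subtype _)).biUnion fun e => {e.1, e.2}) ×ˢ Finset.univ := by
      ext ⟨a, b⟩
      simp only [Finset.mem_biUnion, Finset.mem_product, Finset.mem_univ, and_true]
      constructor
      · rintro ⟨e, he, h⟩
        exact ⟨e.1, Finset.mem_map.2 ⟨e, he, rfl⟩, h⟩
      · rintro ⟨e, he, h⟩
        obtain ⟨e', he', rfl⟩ := Finset.mem_map.1 he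
        exact ⟨e', he', h⟩
    rw [h2, Finset.card_product]
    simpa [mul_comm] using h1
  have hm1 : ∀ e : E, (m e).1 = e.1.1 ∨ (m e).1 = e.1.2 := by
    intro e
    have := (Finset.mem_product.1 (hm e)).1
    simpa using this
  let X : V → Finset V := fun a => Finset.univ.filter
    (fun b => ∃ h : G.Adj a b ∧ c a = true ∧ c b = false, (m ⟨(a, b), h⟩).1 = a)
  have hXcard : ∀ a, (X a).card ≤ 2 := by
    intro a
    have hX : ∀ b ∈ X a, ∃ i : Fin 2, ∃ h : G.Adj a b ∧ c a = true ∧ c b = false,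
        m ⟨(a, b), h⟩ = (a, i) := by
      intro b hb
      obtain ⟨h, hh⟩ := (Finset.mem_filter.1 hb).2
      exact ⟨(m ⟨(a, b), h⟩).2, h, Prod.ext hh rfl⟩
    choose! i hi using hX
    have := Finset.card_le_card_of_injOn (s := X a) (t := (Finset.univ : Finset (Fin 2))) i
      (fun _ _ => Finset.mem_coe.2 (Finset.mem_univ _)) (by
        intro b hb b' hb' e
        obtain ⟨h, h1⟩ := hi b hb
        obtain ⟨h', h1'⟩ := hi b' hb'
        have := hminj (h1.trans ((congrArg (Prod.mk a) e).trans h1'.symm))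
        exact congrArg (fun x : E => x.1.2) this)
    simpa using this
  have hY : ∀ a, ∃ Y : Finset V, X a ⊆ Y ∧ Y ⊆ G.neighborFinset a ∧ Y.card = 3 := by
    intro a
    refine Finset.exists_subsuperset_card_eq ?_ ((hXcard a).trans (by norm_num)) ?_
    · intro b hb
      obtain ⟨h, _⟩ := (Finset.mem_filter.1 hb).2
      simpa using h.1
    · have := hdeg a
      rwa [Set.ncard_eq_toFinset_card'] at this
  choose Y hXY hYN hY3 using hY
  let o : V → V → Prop := fun u v => G.Adj u v ∧
    ((c v = true ∧ u ∈ Y v) ∨ (c v = false ∧ v ∉ Y u))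
  have hflip : ∀ u v, G.Adj u v → (c u = true ∧ c v = false) ∨ (c u = false ∧ c v = true) := by
    intro u v h
    have := hc u v h
    rcases hu : c u with _ | _ <;> rcases hv : c v with _ | _ <;> simp_all
  have ht : ∀ v, c v = true → inDeg o v = 3 := by
    intro v hv
    have : {u | o u v} = (Y v : Set V) := by
      ext u
      rw [Finset.mem_coe]
      constructor
      · rintro ⟨_, ⟨_, h⟩ | ⟨h, _⟩⟩
        · exact h
        · rw [hv] at h; cases h
      · intro h
        have : G.Adj v u := by simpa using hYN v h
        exact ⟨this.symm, Or.inl ⟨hv, h⟩⟩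
    rw [inDeg, this, Set.ncard_coe_finset, hY3]
  have hf : ∀ v, c v = false → inDeg o v ≤ 2 := by
    intro v hv
    have hX : ∀ u ∈ {u | o u v}, ∃ i : Fin 2, ∃ h : G.Adj u v ∧ c u = true ∧ c v = false,
        m ⟨(u, v), h⟩ = (v, i) := by
      rintro u ⟨hadj, h | ⟨_, hn⟩⟩
      · rw [hv] at h; cases h.1
      · have hu : c u = true := by
          rcases hflip u v hadj with h | h
          · exact h.1
          · rw [hv] at h; cases h.2
        refine ⟨(m ⟨(u, v), hadj, hu, hv⟩).2, ⟨hadj, hu, hv⟩, Prod.ext ?_ rfl⟩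
        rcases hm1 ⟨(u, v), hadj, hu, hv⟩ with h | h
        · exact (hn (hXY u (Finset.mem_filter.2 ⟨Finset.mem_univ _, ⟨hadj, hu, hv⟩, h⟩))).elim
        · exact h
    choose! i hi using hX
    have := Set.ncard_le_ncard_of_injOn (s := {u | o u v}) (t := (Set.univ : Set (Fin 2))) i
      (fun _ _ => Set.mem_univ _) (by
        intro b hb b' hb' e
        obtain ⟨h, h1⟩ := hi b hb
        obtain ⟨h', h1'⟩ := hi b' hb'
        have := hminj (h1.trans ((congrArg (Prod.mk v) e).trans h1'.symm))
        exact congrArg (fun x : E => x.1.1) this)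
    simpa [inDeg, Set.ncard_univ] using this
  refine ⟨o, ⟨?_, ?_⟩, ?_, ?_⟩
  · intro u v
    constructor
    · intro h
      rcases hflip u v h with ⟨hu, hv⟩ | ⟨hu, hv⟩
      · by_cases hy : v ∈ Y u
        · exact Or.inr ⟨h.symm, Or.inl ⟨hu, hy⟩⟩
        · exact Or.inl ⟨h, Or.inr ⟨hv, hy⟩⟩
      · by_cases hy : u ∈ Y v
        · exact Or.inl ⟨h, Or.inl ⟨hv, hy⟩⟩
        · exact Or.inr ⟨h.symm, Or.inr ⟨hu, hy⟩⟩
    · rintro (h | h)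
      · exact h.1
      · exact h.1.symm
  · rintro u v ⟨h, h1⟩ ⟨_, h2⟩
    rcases hflip u v h with ⟨hu, hv⟩ | ⟨hu, hv⟩
    · simp only [hu, hv] at h1 h2; simp_all
    · simp only [hu, hv] at h1 h2; simp_all
  · intro u v h
    rcases hflip u v h with ⟨hu, hv⟩ | ⟨hu, hv⟩
    · have := ht u hu; have := hf v hv; omega
    · have := hf u hu; have := ht v hv; omega
  · intro v
    rcases hv : c v with _ | _
    · exact (hf v hv).trans (by norm_num)
    · exact (ht v hv).le
end

section
/- Every 3-connected simple bipartite planar graph has proper orientation number at most 3. -/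
/-- `G` is 3-connected: more than three vertices, and deleting any two
vertices leaves a connected graph. -/
def ThreeConnected {V : Type*} [Fintype V] (G : SimpleGraph V) : Prop :=
  3 < Fintype.card V ∧
    ∀ S : Set V, S.ncard ≤ 2 → ((⊤ : G.Subgraph).deleteVerts S).coe.Connected


namespace TorusGrid

/-- Vertices (and squares) of the toroidal grid. -/
abbrev Pt (N : ℕ) := ZMod N × ZMod N
/-- Edges of the toroidal grid. -/
abbrev Ed (N : ℕ) := Bool × Pt N

def src {N : ℕ} (d : Ed N) : Pt N := d.2
def tgt {N : ℕ} (d : Ed N) : Pt N := d.2 + (if d.1 then (0, 1) else (1, 0))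
def lft {N : ℕ} (d : Ed N) : Pt N := d.2
def rgt {N : ℕ} (d : Ed N) : Pt N := d.2 - (if d.1 then (1, 0) else (0, 1))

/-- Adjacency in the toroidal grid. -/
def gadj {N : ℕ} (a b : Pt N) : Prop :=
  ∃ d : Ed N, (src d = a ∧ tgt d = b) ∨ (src d = b ∧ tgt d = a)

lemma gadj_symm {N : ℕ} {a b : Pt N} (h : gadj a b) : gadj b a := by
  obtain ⟨d, h | h⟩ := h
  · exact ⟨d, Or.inr h⟩
  · exact ⟨d, Or.inl h⟩

lemma cocycle {N : ℕ} [NeZero N] (g φ : Pt N → ZMod 2) :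
    ∑ d : Ed N, (g (lft d) + g (rgt d)) * (φ (src d) + φ (tgt d)) = 0 := by
  have two : ∀ z : ZMod 2, z + z = 0 := by decide
  rw [Fintype.sum_prod_type]
  simp only [Fintype.sum_bool, lft, rgt, src, tgt, if_true, Bool.false_eq_true, if_false]
  set i : Pt N := (1, 0)
  set j : Pt N := (0, 1)
  have e1 : ∑ x : Pt N, g (x - i) * φ x = ∑ x : Pt N, g x * φ (x + i) := by
    rw [← Equiv.sum_comp (Equiv.addRight i)]; simp
  have e2 : ∑ x : Pt N, g (x - j) * φ x = ∑ x : Pt N, g x * φ (x + j) := by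
    rw [← Equiv.sum_comp (Equiv.addRight j)]; simp
  have e3 : ∑ x : Pt N, g (x - i) * φ (x + j) = ∑ x : Pt N, g x * φ (x + i + j) := by
    rw [← Equiv.sum_comp (Equiv.addRight i)]; simp
  have e4 : ∑ x : Pt N, g (x - j) * φ (x + i) = ∑ x : Pt N, g x * φ (x + i + j) := by
    rw [← Equiv.sum_comp (Equiv.addRight j)]; simp [add_right_comm]
  simp only [add_mul, mul_add, Finset.sum_add_distrib, e1, e2, e3, e4]
  generalize ∑ x : Pt N, g x * φ x = a1
  generalize ∑ x : Pt N, g x * φ (x + i) = a2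
  generalize ∑ x : Pt N, g x * φ (x + j) = a3
  generalize ∑ x : Pt N, g x * φ (x + i + j) = a4
  revert a1 a2 a3 a4; decide

lemma const_of_step {N : ℕ} [NeZero N] {α : Type*} (g : Pt N → α)
    (h1 : ∀ x, g (x + (1, 0)) = g x) (h2 : ∀ x, g (x + (0, 1)) = g x) (x y : Pt N) :
    g x = g y := by
  have key : ∀ x : Pt N, g x = g 0 := by
    rintro ⟨a, b⟩
    have ha : ∀ n : ℕ, g ((n : ZMod N), b) = g (0, b) := by
      intro n
      induction n with
      | zero => simp
      | succ n ih => rw [← ih, ← h1 ((n : ZMod N), b)]; simp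
    have hb : ∀ n : ℕ, g (0, (n : ZMod N)) = g (0, 0) := by
      intro n
      induction n with
      | zero => simp
      | succ n ih => rw [← ih, ← h2 (0, (n : ZMod N))]; simp
    have := ha a.val
    have h' := hb b.val
    rw [ZMod.natCast_zmod_val] at this h'
    rw [this, h']; rfl
  rw [key x, key y]

lemma card_le_quot {P J : Type*} [Fintype P] [Fintype J] (l r : J → P) :
    Fintype.card P ≤ Fintype.card J +
      Nat.card (Quot (fun x y => ∃ j, l j = x ∧ r j = y)) := by
  classical
  set Q := Quot (fun x y => ∃ j, l j = x ∧ r j = y)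
  have : Fintype Q := Fintype.ofFinite Q
  let f : (P → ZMod 2) →ₗ[ZMod 2] (J → ZMod 2) :=
    LinearMap.funLeft (ZMod 2) (ZMod 2) l - LinearMap.funLeft (ZMod 2) (ZMod 2) r
  let q : (Q → ZMod 2) →ₗ[ZMod 2] (P → ZMod 2) :=
    LinearMap.funLeft (ZMod 2) (ZMod 2) (fun x => (Quot.mk _ x : Q))
  have hk : LinearMap.ker f ≤ LinearMap.range q := by
    intro g hg
    have hg' : ∀ j, g (l j) = g (r j) := by
      intro j
      have := congrFun (LinearMap.mem_ker.1 hg) j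
      simpa [f, sub_eq_zero, LinearMap.funLeft] using this
    refine ⟨fun z => Quot.lift g ?_ z, ?_⟩
    · rintro a b ⟨j, rfl, rfl⟩; exact hg' j
    · ext x; rfl
  have h1 := LinearMap.finrank_range_add_finrank_ker f
  have h2 := Submodule.finrank_mono hk
  have h3 := LinearMap.finrank_range_le q
  have h4 := Submodule.finrank_le (LinearMap.range f)
  simp only [Module.finrank_fintype_fun_eq_card] at *
  rw [Nat.card_eq_fintype_card]
  omega

/-- An even nonempty edge set in a simple bipartite graph has at least four edges. -/
lemma four_le {V E : Type*} [DecidableEq V] [Fintype E] (s t : E → V) (c : V → Bool)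
    (hs : ∀ e, c (s e) = true) (ht : ∀ e, c (t e) = false)
    (hinj : ∀ e e', s e = s e' → t e = t e' → e = e')
    (w : E → ZMod 2)
    (hw : ∀ v, ∑ e, w e * ((if s e = v then 1 else 0) + (if t e = v then 1 else 0)) = 0)
    (e₀ : E) (h0 : w e₀ ≠ 0) : 4 ≤ (Finset.univ.filter (fun e => w e ≠ 0)).card := by
  classical
  have hst : ∀ e e', s e ≠ t e' := by
    intro e e' h
    have := hs e; rw [h, ht] at this; cases this
  have one : ∀ z : ZMod 2, z ≠ 0 → z = 1 := by decide
  have next_s : ∀ e, w e ≠ 0 → ∃ e', w e' ≠ 0 ∧ s e' = s e ∧ e' ≠ e := by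
    intro e he
    by_contra! hcon
    have := hw (s e)
    rw [Finset.sum_eq_single e] at this
    · simp [(hst e e).symm] at this; exact he this
    · intro b _ hb
      by_cases h : w b = 0
      · simp [h]
      · have : s b ≠ s e := fun h' => hb (hcon b h h')
        simp [this, (hst e b).symm]
    · simp
  have next_t : ∀ e, w e ≠ 0 → ∃ e', w e' ≠ 0 ∧ t e' = t e ∧ e' ≠ e := by
    intro e he
    by_contra! hcon
    have := hw (t e)
    rw [Finset.sum_eq_single e] at this
    · simp [(hst e e)] at this; exact he this
    · intro b _ hb
      by_cases h : w b = 0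
      · simp [h]
      · have : t b ≠ t e := fun h' => hb (hcon b h h')
        simp [this, (hst b e)]
    · simp
  obtain ⟨e1, w1, s1, n1⟩ := next_s e₀ h0
  obtain ⟨e2, w2, t2, n2⟩ := next_t e₀ h0
  obtain ⟨e3, w3, t3, n3⟩ := next_t e1 w1
  have t10 : t e1 ≠ t e₀ := fun h => n1 (hinj _ _ s1 h)
  have hsub : ({e₀, e1, e2, e3} : Finset E) ⊆ Finset.univ.filter (fun e => w e ≠ 0) := by
    intro e he
    simp only [Finset.mem_insert, Finset.mem_singleton] at he
    rcases he with rfl | rfl | rfl | rfl <;> simpa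
  have h12 : e1 ≠ e2 := by rintro rfl; exact t10 t2
  have h30 : e3 ≠ e₀ := by rintro rfl; exact t10 t3.symm
  have h32 : e3 ≠ e2 := by rintro rfl; exact t10 (t3.symm.trans t2)
  refine le_trans ?_ (Finset.card_le_card hsub)
  rw [Finset.card_insert_of_notMem, Finset.card_insert_of_notMem, Finset.card_pair h32.symm]
  · simp [h12, n3.symm]
  · simp [n1.symm, n2.symm, h30.symm]

theorem torus_bound {N : ℕ} [NeZero N] {V E : Type*} [Fintype V] [Fintype E]
    (s t : E → V) (c : V → Bool)
    (hs : ∀ e, c (s e) = true) (ht : ∀ e, c (t e) = false)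
    (hinj : ∀ e e', s e = s e' → t e = t e' → e = e')
    (β : Pt N → V) (hsurj : Function.Surjective β)
    (hconn : ∀ x y, β x = β y → Relation.ReflTransGen (fun a b => gadj a b ∧ β a = β b) x y)
    (hE : ∀ e, ∃ a b, gadj a b ∧ β a = s e ∧ β b = t e) :
    Fintype.card E ≤ 2 * Fintype.card V := by
  classical
  have hst : ∀ e e', s e ≠ t e' := by
    intro e e' h
    have := hs e; rw [h, ht] at this; cases this
  choose root hroot using hsurj
  -- depth
  let Γ : SimpleGraph (Pt N) := SimpleGraph.fromRel (fun a b => gadj a b ∧ β a = β b)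
  have hreach : ∀ x y, β x = β y → Γ.Reachable x y := by
    intro x y h
    have := hconn x y h
    clear h
    induction this with
    | refl => exact SimpleGraph.Reachable.refl _
    | tail _ hbc ih =>
      rename_i b z _
      by_cases hne : b = z
      · subst hne; exact ih
      · exact ih.trans (SimpleGraph.Adj.reachable (by
          rw [SimpleGraph.fromRel_adj]; exact ⟨hne, Or.inl hbc⟩))
  let depth : Pt N → ℕ := fun x => Γ.dist x (root (β x))
  have hpar : ∀ x : {x : Pt N // x ≠ root (β x)}, ∃ y, gadj x.1 y ∧ β x.1 = β y ∧
      depth y < depth x.1 := by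
    rintro ⟨x, hx⟩
    obtain ⟨p, hp⟩ := (hreach x (root (β x)) (hroot _).symm).exists_walk_length_eq_dist
    change p.length = depth x at hp
    change ∃ y, gadj x y ∧ β x = β y ∧ depth y < depth x
    generalize hr : root (β x) = r at hx p
    cases p with
    | nil => exact absurd rfl hx
    | cons hadj p =>
      rename_i y
      rw [SimpleGraph.fromRel_adj] at hadj
      have hxy : gadj x y ∧ β x = β y := by
        rcases hadj.2 with h | h
        · exact h
        · exact ⟨gadj_symm h.1, h.2.symm⟩
      refine ⟨y, hxy.1, hxy.2, ?_⟩
      have : depth y ≤ p.length := by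
        change Γ.dist y (root (β y)) ≤ _
        rw [← hxy.2, hr]; exact SimpleGraph.dist_le p
      simp at hp; omega
  choose par hgp hβp hdp using hpar
  choose τ hτ using hgp
  choose a b hab ha hb using hE
  choose μ hμ using hab
  have hτβ : ∀ x, β (src (τ x)) = β (tgt (τ x)) := by
    intro x
    rcases hτ x with ⟨h1, h2⟩ | ⟨h1, h2⟩ <;> rw [h1, h2, hβp x]
  have hτinj : Function.Injective τ := by
    intro x y hxy
    by_contra hne
    have hne' : x.1 ≠ y.1 := fun h => hne (Subtype.ext h)
    have hx := hτ x
    have hy := hτ y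
    rw [hxy] at hx
    have h1 := hdp x
    have h2 := hdp y
    rcases hx with ⟨p1, p2⟩ | ⟨p1, p2⟩ <;> rcases hy with ⟨q1, q2⟩ | ⟨q1, q2⟩
    · exact hne' (p1.symm.trans q1)
    · rw [← p2, q2] at h1; rw [← q1, p1] at h2; omega
    · rw [← p1, q1] at h1; rw [← q2, p2] at h2; omega
    · exact hne' (p2.symm.trans q2)
  have hμinj : Function.Injective μ := by
    intro e e' h
    have h1 := hμ e
    have h2 := hμ e'
    rw [h] at h1
    have := hst e e'
    have := hst e' e
    apply hinj <;> grind
  have hτμ : ∀ x e, τ x ≠ μ e := by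
    intro x e h
    have h1 := hτβ x
    rw [h] at h1
    have h2 := hst e e
    have h3 := hμ e
    grind
  let κ : {x : Pt N // x ≠ root (β x)} ⊕ E → Ed N := Sum.elim τ μ
  have hκ : Function.Injective κ := by
    rintro (x | e) (y | e') h
    · exact congrArg _ (hτinj h)
    · exact absurd h (hτμ _ _)
    · exact absurd h.symm (hτμ _ _)
    · exact congrArg _ (hμinj h)
  let J := {d : Ed N // d ∉ Set.range κ}
  let l : J → Pt N := fun j => lft j.1
  let r : J → Pt N := fun j => rgt j.1
  have hF := card_le_quot l r
  set Q := Quot (fun x y => ∃ j, l j = x ∧ r j = y) with hQ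
  have : Fintype Q := Fintype.ofFinite Q
  rw [Nat.card_eq_fintype_card] at hF
  have cardJ : Fintype.card J + (Fintype.card {x : Pt N // x ≠ root (β x)} + Fintype.card E)
      = 2 * Fintype.card (Pt N) := by
    have h1 : Fintype.card J = Fintype.card (Ed N) - Fintype.card (Set.range κ) :=
      Fintype.card_subtype_compl (fun d => d ∈ Set.range κ)
    have h2 : Fintype.card (Set.range κ) = _ := Set.card_range_of_injective hκ
    have h3 : Fintype.card (Set.range κ) ≤ Fintype.card (Ed N) :=
      Fintype.card_subtype_le (fun d => d ∈ Set.range κ)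
    rw [Fintype.card_sum] at h2
    have h4 : Fintype.card (Ed N) = 2 * Fintype.card (Pt N) := by
      rw [Fintype.card_prod, Fintype.card_bool]
    omega
  have cardNR : Fintype.card {x : Pt N // x ≠ root (β x)} + Fintype.card V
      = Fintype.card (Pt N) := by
    have h1 : Fintype.card {x : Pt N // x = root (β x)} = Fintype.card V := by
      refine Fintype.card_congr ⟨fun x => β x.1, fun v => ⟨root v, by rw [hroot]⟩, ?_, ?_⟩
      · intro x; exact Subtype.ext x.2.symm
      · intro v; exact hroot v
    have h2 : Fintype.card {x : Pt N // x ≠ root (β x)} = _ :=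
      Fintype.card_subtype_compl (fun x => x = root (β x))
    have h3 : Fintype.card {x : Pt N // x = root (β x)} ≤ _ :=
      Fintype.card_subtype_le (fun x => x = root (β x))
    omega
  have hVpos : 0 < Fintype.card V := Fintype.card_pos_iff.2 ⟨β 0⟩
  by_cases hQ1 : Fintype.card Q ≤ 1
  · omega
  -- face indicators
  let g : Q → Pt N → ZMod 2 := fun f x => if (Quot.mk _ x : Q) = f then 1 else 0
  let bd : Q → Ed N → ZMod 2 := fun f d => g f (lft d) + g f (rgt d)
  have two : ∀ z : ZMod 2, z + z = 0 := by decide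
  have eq_of : ∀ z w : ZMod 2, z + w = 0 → z = w := by decide
  have hbd0 : ∀ f d, d ∉ Set.range κ → bd f d = 0 := by
    intro f d hd
    have : (Quot.mk _ (lft d) : Q) = Quot.mk _ (rgt d) := Quot.sound ⟨⟨d, hd⟩, rfl, rfl⟩
    simp only [bd, g, this]; exact two _
  have hsum : ∀ f (φ : Pt N → ZMod 2),
      ∑ x, bd f (τ x) * (φ (src (τ x)) + φ (tgt (τ x))) +
      ∑ e, bd f (μ e) * (φ (src (μ e)) + φ (tgt (μ e))) = 0 := by
    intro f φ
    have h := cocycle (g f) φ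
    have h2 := Fintype.sum_of_injective κ hκ
      (fun z => bd f (κ z) * (φ (src (κ z)) + φ (tgt (κ z))))
      (fun d => bd f d * (φ (src d) + φ (tgt d)))
      (fun d hd => by simp only [hbd0 f d hd, zero_mul]) (fun _ => rfl)
    rw [Fintype.sum_sum_type] at h2
    exact h2.trans h
  have claimA : ∀ f, ∃ e, bd f (μ e) ≠ 0 := by
    intro f
    by_contra! hcon
    have hτ0 : ∀ x, bd f (τ x) = 0 := by
      by_contra! hx
      obtain ⟨x₀, hx₀⟩ := hx
      obtain ⟨x, hx, hmax⟩ := Finset.exists_max_image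
        (Finset.univ.filter (fun x => bd f (τ x) ≠ 0)) (fun x => depth x.1) ⟨x₀, by simpa⟩
      simp only [Finset.mem_filter, Finset.mem_univ, true_and] at hx hmax
      have h := hsum f (fun y => if y = x.1 then 1 else 0)
      simp only [hcon, zero_mul, Finset.sum_const_zero, add_zero] at h
      have hne : ∀ y, bd f (τ y) ≠ 0 → par y ≠ x.1 := by
        intro y hy h
        have h1 := hmax y hy
        have h2 := hdp y
        rw [h] at h2; omega
      rw [Finset.sum_eq_single x] at h
      · have := hne x hx
        rcases hτ x with ⟨p, q⟩ | ⟨p, q⟩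
        · rw [p, q] at h; simp [this] at h; exact hx h
        · rw [p, q] at h; simp [this] at h; exact hx h
      · intro y _ hyx
        by_cases hy : bd f (τ y) = 0
        · simp [hy]
        · have h1 := hne y hy
          have h2 : y.1 ≠ x.1 := fun h => hyx (Subtype.ext h)
          rcases hτ y with ⟨p, q⟩ | ⟨p, q⟩
          · rw [p, q]; simp [h1, h2]
          · rw [p, q]; simp [h1, h2]
      · simp
    have hall : ∀ d, bd f d = 0 := by
      intro d
      by_cases hd : d ∈ Set.range κ
      · obtain ⟨x | e, rfl⟩ := hd
        · exact hτ0 x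
        · exact hcon e
      · exact hbd0 f d hd
    have hconst : ∀ x y, g f x = g f y := by
      apply const_of_step
      · intro x
        have := eq_of _ _ (hall (true, x + (1, 0)))
        simpa [lft, rgt] using this
      · intro x
        have := eq_of _ _ (hall (false, x + (0, 1)))
        simpa [lft, rgt] using this
    apply hQ1
    obtain ⟨x, hx⟩ := Quot.exists_rep f
    have : ∀ q : Q, q = f := by
      intro q
      obtain ⟨y, hy⟩ := Quot.exists_rep q
      have h := hconst x y
      simp only [g, hx, hy, if_true] at h
      by_contra hq
      simp [hq] at h
    exact Fintype.card_le_one_iff.2 (fun p q => (this p).trans (this q).symm)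
  have claimB : ∀ f, 4 ≤ (Finset.univ.filter (fun e => bd f (μ e) ≠ 0)).card := by
    intro f
    obtain ⟨e₀, h0⟩ := claimA f
    refine four_le s t c hs ht hinj (fun e => bd f (μ e)) ?_ e₀ h0
    intro v
    have h := hsum f (fun y => if β y = v then 1 else 0)
    simp only [hτβ, two, mul_zero, Finset.sum_const_zero, zero_add] at h
    refine Eq.trans ?_ h
    apply Finset.sum_congr rfl
    intro e _
    rcases hμ e with ⟨p, q⟩ | ⟨p, q⟩
    · rw [p, q, ha, hb]
    · rw [p, q, ha, hb, add_comm]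
  have hdc := Finset.sum_card_bipartiteAbove_eq_sum_card_bipartiteBelow
    (s := (Finset.univ : Finset Q)) (t := (Finset.univ : Finset E))
    (fun f e => bd f (μ e) ≠ 0)
  have hlow : Fintype.card Q * 4 ≤ ∑ f : Q, (Finset.univ.filter (fun e => bd f (μ e) ≠ 0)).card := by
    have := Finset.card_nsmul_le_sum Finset.univ
      (fun f : Q => (Finset.univ.filter (fun e => bd f (μ e) ≠ 0)).card) 4 (fun f _ => claimB f)
    simpa using this
  have hup : ∑ e : E, (Finset.univ.filter (fun f => bd f (μ e) ≠ 0)).card ≤ Fintype.card E * 2 := by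
    have := Finset.sum_le_card_nsmul Finset.univ
      (fun e : E => (Finset.univ.filter (fun f => bd f (μ e) ≠ 0)).card) 2 (fun e _ => by
        refine le_trans (Finset.card_le_card (t := {Quot.mk _ (lft (μ e)), Quot.mk _ (rgt (μ e))}) ?_)
          Finset.card_le_two
        intro f hf
        simp only [Finset.mem_filter, Finset.mem_univ, true_and] at hf
        simp only [Finset.mem_insert, Finset.mem_singleton]
        by_contra! hcon
        apply hf
        simp only [bd, g]
        rw [if_neg hcon.1.symm, if_neg hcon.2.symm, add_zero])
    simpa using this
  simp only [Finset.bipartiteAbove, Finset.bipartiteBelow] at hdc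
  omega

end TorusGrid
namespace TorusGrid

lemma rtg_mono {α : Type*} {r q : α → α → Prop} (h : ∀ a b, r a b → q a b) {x y : α}
    (hxy : Relation.ReflTransGen r x y) : Relation.ReflTransGen q x y := by
  induction hxy with
  | refl => exact .refl
  | tail _ hbc ih => exact ih.tail (h _ _ hbc)

/-- Reachability in the toroidal grid inside a set of vertices. -/
def CR {N : ℕ} (S : Set (Pt N)) : Pt N → Pt N → Prop :=
  Relation.ReflTransGen (fun a b => gadj a b ∧ a ∈ S ∧ b ∈ S)

lemma CR.symm {N : ℕ} {S : Set (Pt N)} {a b : Pt N} (h : CR S a b) : CR S b a := by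
  induction h with
  | refl => exact .refl
  | tail _ h ih => exact Relation.ReflTransGen.head ⟨gadj_symm h.1, h.2.2, h.2.1⟩ ih

lemma CR.mono {N : ℕ} {S T : Set (Pt N)} (hST : S ⊆ T) {a b : Pt N} (h : CR S a b) :
    CR T a b :=
  rtg_mono (fun _ _ h => ⟨h.1, hST h.2.1, hST h.2.2⟩) h

lemma exists_crossing {α : Type*} {r : α → α → Prop} {x y : α}
    (h : Relation.ReflTransGen r x y) (P : α → Prop) (hx : P x) (hy : ¬ P y) :
    ∃ a b, r a b ∧ P a ∧ ¬ P b := by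
  induction h with
  | refl => exact absurd hx hy
  | tail _ hbc ih =>
    rename_i b z _
    by_cases hb : P b
    · exact ⟨b, z, hbc, hb, hy⟩
    · exact ih hb

/-- A system of disjoint connected branch sets with base points. -/
def Good {N : ℕ} {V : Type*} (p : V → Pt N) (B : V → Set (Pt N)) : Prop :=
  (∀ v, p v ∈ B v) ∧ (∀ u v x, x ∈ B u → x ∈ B v → u = v) ∧
    ∀ v x, x ∈ B v → CR (B v) (p v) x

lemma extend_good {N : ℕ} [NeZero N] {V : Type*} [Finite V] [Nonempty V] (p : V → Pt N)
    (B : V → Set (Pt N)) (hB : Good p B) :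
    ∃ B', B ≤ B' ∧ Good p B' ∧ ∀ x, ∃ v, x ∈ B' v := by
  classical
  obtain ⟨B', hle, hmax⟩ := (Set.toFinite {B | Good p B}).exists_le_maximal hB
  refine ⟨B', hle, hmax.1, ?_⟩
  obtain ⟨h1, h2, h3⟩ := hmax.1
  by_contra! hcon
  obtain ⟨x₀, hx₀⟩ := hcon
  -- find an adjacent pair
  have key : ∃ a b v, gadj a b ∧ a ∈ B' v ∧ ∀ u, b ∉ B' u := by
    by_contra! hno
    have step : ∀ a b, gadj a b → ((∃ v, a ∈ B' v) ↔ ∃ v, b ∈ B' v) := by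
      intro a b hab
      constructor
      · rintro ⟨v, hv⟩; exact hno a b v hab hv
      · rintro ⟨v, hv⟩; exact hno b a v (gadj_symm hab) hv
    obtain ⟨v⟩ := ‹Nonempty V›
    have := const_of_step (fun a : Pt N => ∃ v, a ∈ B' v)
      (fun x => propext (step _ _ ⟨(false, x), Or.inr ⟨rfl, by simp [tgt]⟩⟩))
      (fun x => propext (step _ _ ⟨(true, x), Or.inr ⟨rfl, by simp [tgt]⟩⟩)) (p v) x₀
    have h : ∃ u, x₀ ∈ B' u := by
      have h' : ∃ u, p v ∈ B' u := ⟨v, h1 v⟩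
      exact this ▸ h'
    obtain ⟨u, hu⟩ := h
    exact hx₀ u hu
  obtain ⟨a, b, v, hab, hav, hb⟩ := key
  let B'' : V → Set (Pt N) := fun u => if u = v then insert b (B' u) else B' u
  have hsub : ∀ u, B' u ⊆ B'' u := by
    intro u x hx
    by_cases h : u = v
    · simp [B'', h]; right; exact h ▸ hx
    · simpa [B'', h] using hx
  have hmem : ∀ u x, x ∈ B'' u → x ∈ B' u ∨ (u = v ∧ x = b) := by
    intro u x hx
    by_cases h : u = v
    · simp only [B'', h, if_true, Set.mem_insert_iff] at hx
      rcases hx with hx | hx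
      · exact Or.inr ⟨h, hx⟩
      · exact Or.inl (h ▸ hx)
    · simp only [B'', h, if_false] at hx; exact Or.inl hx
  have hbv : b ∈ B'' v := by simp [B'']
  have hgood : Good p B'' := by
    refine ⟨fun u => hsub u (h1 u), ?_, ?_⟩
    · intro u w x hu hw
      rcases hmem _ _ hu with hu1 | ⟨hu1, hxu⟩ <;> rcases hmem _ _ hw with hw1 | ⟨hw1, hxw⟩
      · exact h2 _ _ _ hu1 hw1
      · subst hxw; exact absurd hu1 (hb _)
      · subst hxu; exact absurd hw1 (hb _)
      · rw [hu1, hw1]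
    · intro u x hx
      rcases hmem _ _ hx with hx | ⟨hu, hxu⟩
      · exact (h3 u x hx).mono (hsub u)
      · subst hu hxu
        exact ((h3 u a hav).mono (hsub u)).tail ⟨hab, hsub u hav, hbv⟩
  have := hmax.2 hgood hsub v hbv
  exact hb v this

theorem minor_bound {N : ℕ} [NeZero N] {V E : Type*} [Fintype V] [Fintype E] [Nonempty V]
    (s t : E → V) (c : V → Bool)
    (hs : ∀ e, c (s e) = true) (ht : ∀ e, c (t e) = false)
    (hinj : ∀ e e', s e = s e' → t e = t e' → e = e')
    (A : V → Set (Pt N)) (L : E → Set (Pt N))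
    (hne : ∀ v, (A v).Nonempty)
    (hAd : ∀ u v x, x ∈ A u → x ∈ A v → u = v)
    (hAc : ∀ v, ∀ x ∈ A v, ∀ y ∈ A v, CR (A v) x y)
    (hLc : ∀ e, ∀ x ∈ L e, ∀ y ∈ L e, CR (L e) x y)
    (hLs : ∀ e, (L e ∩ A (s e)).Nonempty)
    (hLt : ∀ e, (L e ∩ A (t e)).Nonempty)
    (hLA : ∀ e v x, x ∈ L e → x ∈ A v → v = s e ∨ v = t e)
    (hLL : ∀ e e' x, x ∈ L e → x ∈ L e' → e = e') :
    Fintype.card E ≤ 2 * Fintype.card V := by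
  have hst : ∀ e e', s e ≠ t e' := by
    intro e e' h
    have := hs e; rw [h, ht] at this; cases this
  choose p hp using hne
  let R : E → Set (Pt N) := fun e => {x | x ∈ L e ∧ x ∉ A (t e) ∧
    ∃ y, y ∈ L e ∧ y ∈ A (s e) ∧ CR (L e \ A (t e)) y x}
  have hexit : ∀ e, ∃ a b, gadj a b ∧ a ∈ R e ∧ b ∈ A (t e) := by
    intro e
    obtain ⟨y, hyL, hyA⟩ := hLs e
    obtain ⟨z, hzL, hzA⟩ := hLt e
    have hyR : y ∈ R e := ⟨hyL, fun h => hst e e (hAd _ _ _ hyA h), y, hyL, hyA, .refl⟩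
    have hzR : z ∉ R e := fun h => h.2.1 hzA
    obtain ⟨a, b, ⟨hab, haL, hbL⟩, ha, hb⟩ :=
      exists_crossing (hLc e y hyL z hzL) (· ∈ R e) hyR hzR
    refine ⟨a, b, hab, ha, ?_⟩
    by_contra hbA
    apply hb
    obtain ⟨_, haA, w, hwL, hwA, hw⟩ := ha
    exact ⟨hbL, hbA, w, hwL, hwA, hw.tail ⟨hab, ⟨haL, haA⟩, hbL, hbA⟩⟩
  let B : V → Set (Pt N) := fun v => A v ∪ {x | ∃ e, s e = v ∧ x ∈ R e}
  have hB : Good p B := by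
    refine ⟨fun v => Or.inl (hp v), ?_, ?_⟩
    · have aux : ∀ u x e, x ∈ A u → x ∈ R e → u = s e := by
        intro u x e hx hR
        rcases hLA e u x hR.1 hx with h | h
        · exact h
        · exact absurd (h ▸ hx) hR.2.1
      rintro u v x (hu | ⟨e, he, hu⟩) (hv | ⟨e', he', hv⟩)
      · exact hAd _ _ _ hu hv
      · rw [← he']; exact aux _ _ _ hu hv
      · rw [← he]; exact (aux _ _ _ hv hu).symm
      · rw [← he, ← he', hLL e e' x hu.1 hv.1]
    · rintro v x (hx | ⟨e, rfl, hx⟩)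
      · exact (hAc v _ (hp v) x hx).mono Set.subset_union_left
      · obtain ⟨hxL, hxA, y, hyL, hyA, hyx⟩ := hx
        have h1 : CR (B (s e)) (p (s e)) y :=
          (hAc _ _ (hp _) y hyA).mono Set.subset_union_left
        have h2 : CR (B (s e)) y x := by
          have hyA' : y ∉ A (t e) := fun h => hst e e (hAd _ _ _ hyA h)
          have : ∀ z, CR (L e \ A (t e)) y z → z ∈ L e → z ∉ A (t e) → z ∈ R e :=
            fun z hz h1 h2 => ⟨h1, h2, y, hyL, hyA, hz⟩
          clear hxL hxA
          induction hyx with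
          | refl => exact .refl
          | tail hyb hbc ih =>
            refine ih.tail ⟨hbc.1, Or.inr ⟨e, rfl, this _ hyb hbc.2.1.1 hbc.2.1.2⟩,
              Or.inr ⟨e, rfl, this _ (hyb.tail hbc) hbc.2.2.1 hbc.2.2.2⟩⟩
        exact h1.trans h2
  obtain ⟨B', hle, ⟨h1, h2, h3⟩, hcov⟩ := extend_good p B hB
  choose β hβ using hcov
  have hβeq : ∀ x v, x ∈ B' v → β x = v := fun x v hx => h2 _ _ x (hβ x) hx
  refine torus_bound s t c hs ht hinj β (fun v => ⟨p v, hβeq _ _ (h1 v)⟩) ?_ ?_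
  · intro x y hxy
    have hx := h3 _ x (hβ x)
    have hy := h3 _ y (hβ y)
    rw [← hxy] at hy
    have : CR (B' (β x)) x y := hx.symm.trans hy
    exact rtg_mono
      (fun a b h => ⟨h.1, (hβeq _ _ h.2.1).trans (hβeq _ _ h.2.2).symm⟩) this
  · intro e
    obtain ⟨a, b, hab, ha, hb⟩ := hexit e
    exact ⟨a, b, hab, hβeq _ _ (hle _ (Or.inr ⟨e, rfl, ha⟩)), hβeq _ _ (hle _ (Or.inl hb))⟩

end TorusGrid
namespace TorusGrid

/-- Integer cell of a point in the plane for mesh `δ`. -/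
noncomputable def fl (δ : ℝ) (p : ℝ × ℝ) : ℤ × ℤ := (⌊p.1 / δ⌋, ⌊p.2 / δ⌋)

/-- Reduction of an integer point to the torus. -/
def red (N : ℕ) (a : ℤ × ℤ) : Pt N := ((a.1 : ZMod N), (a.2 : ZMod N))

/-- Discrete neighbourhood of a planar set. -/
def Nb (N : ℕ) (δ : ℝ) (A : Set (ℝ × ℝ)) : Set (Pt N) :=
  {x | ∃ p ∈ A, ∃ a : ℤ × ℤ, |a.1 - (fl δ p).1| ≤ 1 ∧ |a.2 - (fl δ p).2| ≤ 1 ∧ red N a = x}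

lemma hstep (N : ℕ) (S : Set (Pt N)) (i i' j : ℤ) (h : |i - i'| ≤ 1)
    (h1 : red N (i', j) ∈ S) (h2 : red N (i, j) ∈ S) : CR S (red N (i', j)) (red N (i, j)) := by
  rw [abs_le] at h
  have : i = i' ∨ i = i' + 1 ∨ i' = i + 1 := by omega
  rcases this with rfl | rfl | rfl
  · exact .refl
  · exact .single ⟨⟨(false, red N (i', j)), Or.inl ⟨rfl, by simp [tgt, red]⟩⟩, h1, h2⟩
  · exact .single ⟨⟨(false, red N (i, j)), Or.inr ⟨rfl, by simp [tgt, red]⟩⟩, h1, h2⟩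

lemma vstep (N : ℕ) (S : Set (Pt N)) (i j j' : ℤ) (h : |j - j'| ≤ 1)
    (h1 : red N (i, j') ∈ S) (h2 : red N (i, j) ∈ S) : CR S (red N (i, j')) (red N (i, j)) := by
  rw [abs_le] at h
  have : j = j' ∨ j = j' + 1 ∨ j' = j + 1 := by omega
  rcases this with rfl | rfl | rfl
  · exact .refl
  · exact .single ⟨⟨(true, red N (i, j')), Or.inl ⟨rfl, by simp [tgt, red]⟩⟩, h1, h2⟩
  · exact .single ⟨⟨(true, red N (i, j)), Or.inr ⟨rfl, by simp [tgt, red]⟩⟩, h1, h2⟩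

lemma block_conn (N : ℕ) (δ : ℝ) (A : Set (ℝ × ℝ)) (p : ℝ × ℝ) (hp : p ∈ A) (a : ℤ × ℤ)
    (h1 : |a.1 - (fl δ p).1| ≤ 1) (h2 : |a.2 - (fl δ p).2| ≤ 1) :
    CR (Nb N δ A) (red N (fl δ p)) (red N a) := by
  have m0 : red N (fl δ p) ∈ Nb N δ A := ⟨p, hp, fl δ p, by simp, by simp, rfl⟩
  have m1 : red N (a.1, (fl δ p).2) ∈ Nb N δ A := ⟨p, hp, (a.1, (fl δ p).2), h1, by simp, rfl⟩
  have m2 : red N a ∈ Nb N δ A := ⟨p, hp, _, h1, h2, rfl⟩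
  exact (hstep N _ a.1 (fl δ p).1 (fl δ p).2 h1 m0 m1).trans
    (vstep N _ a.1 a.2 (fl δ p).2 h2 m1 m2)

lemma floor_close {δ x y : ℝ} (hδ : 0 < δ) (h : |x - y| < δ) : |⌊x / δ⌋ - ⌊y / δ⌋| ≤ 1 := by
  have h' : |x / δ - y / δ| < 1 := by
    rw [← sub_div, abs_div, abs_of_pos hδ, div_lt_one hδ]; exact h
  rw [abs_lt] at h'
  have a1 := Int.floor_le (x / δ)
  have a2 := Int.lt_floor_add_one (x / δ)
  have b1 := Int.floor_le (y / δ)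
  have b2 := Int.lt_floor_add_one (y / δ)
  have c1 : ((⌊x / δ⌋ : ℤ) : ℝ) < ((⌊y / δ⌋ + 2 : ℤ) : ℝ) := by push_cast; linarith
  have c2 : ((⌊y / δ⌋ : ℤ) : ℝ) < ((⌊x / δ⌋ + 2 : ℤ) : ℝ) := by push_cast; linarith
  have c1' := Int.cast_lt.1 c1
  have c2' := Int.cast_lt.1 c2
  rw [abs_le]; omega

lemma Nb_conn (N : ℕ) {δ : ℝ} (hδ : 0 < δ) (A : Set (ℝ × ℝ)) (hA : IsPreconnected A) :
    ∀ x ∈ Nb N δ A, ∀ y ∈ Nb N δ A, CR (Nb N δ A) x y := by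
  have key : ∀ p ∈ A, ∀ q ∈ A, CR (Nb N δ A) (red N (fl δ p)) (red N (fl δ q)) := by
    intro p hp q hq
    refine hA.induction₂ (fun p q => CR (Nb N δ A) (red N (fl δ p)) (red N (fl δ q))) ?_ ?_ ?_ hp hq
    · intro x hx
      rw [eventually_nhdsWithin_iff]
      filter_upwards [Metric.ball_mem_nhds x hδ] with y hy hyA
      rw [Metric.mem_ball, Prod.dist_eq, max_lt_iff] at hy
      exact block_conn N δ A x hx _ (floor_close hδ hy.1) (floor_close hδ hy.2)
    · intro x y z _ _ _ h1 h2
      exact h1.trans h2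
    · intro x y _ _ h
      exact h.symm
  rintro x ⟨p, hp, a, ha1, ha2, rfl⟩ y ⟨q, hq, b, hb1, hb2, rfl⟩
  exact ((block_conn N δ A p hp a ha1 ha2).symm.trans (key p hp q hq)).trans
    (block_conn N δ A q hq b hb1 hb2)

lemma coord_close {N : ℕ} {δ R x y : ℝ} {i j : ℤ} (hδ : 0 < δ) (hx : |x| ≤ R) (hy : |y| ≤ R)
    (hN : 2 * R / δ + 10 < N) (hi : |i - ⌊x / δ⌋| ≤ 1) (hj : |j - ⌊y / δ⌋| ≤ 1)
    (hij : (i : ZMod N) = (j : ZMod N)) : |x - y| < 3 * δ := by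
  have a1 := Int.floor_le (x / δ)
  have a2 := Int.lt_floor_add_one (x / δ)
  have b1 := Int.floor_le (y / δ)
  have b2 := Int.lt_floor_add_one (y / δ)
  rw [abs_le] at hx hy hi hj
  have x1 : x / δ ≤ R / δ := by gcongr; exact hx.2
  have x2 : -(R / δ) ≤ x / δ := by rw [← neg_div]; gcongr; exact hx.1
  have y1 : y / δ ≤ R / δ := by gcongr; exact hy.2
  have y2 : -(R / δ) ≤ y / δ := by rw [← neg_div]; gcongr; exact hy.1
  have hN' : 2 * (R / δ) + 10 < N := by rw [← mul_div_assoc]; exact hN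
  have i1 : (i : ℝ) ≤ ⌊x / δ⌋ + 1 := by exact_mod_cast (by omega : i ≤ ⌊x / δ⌋ + 1)
  have i2 : (⌊x / δ⌋ : ℝ) - 1 ≤ i := by exact_mod_cast (by omega : ⌊x / δ⌋ - 1 ≤ i)
  have j1 : (j : ℝ) ≤ ⌊y / δ⌋ + 1 := by exact_mod_cast (by omega : j ≤ ⌊y / δ⌋ + 1)
  have j2 : (⌊y / δ⌋ : ℝ) - 1 ≤ j := by exact_mod_cast (by omega : ⌊y / δ⌋ - 1 ≤ j)
  have hlt : |j - i| < (N : ℤ) := by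
    have : |(j : ℝ) - i| < N := by rw [abs_lt]; constructor <;> linarith
    exact_mod_cast this
  have hdvd : (N : ℤ) ∣ j - i := (ZMod.intCast_eq_intCast_iff_dvd_sub i j N).1 hij
  have h0 : j - i = 0 := Int.eq_zero_of_abs_lt_dvd hdvd hlt
  have hji : (j : ℝ) = i := by exact_mod_cast (by omega : j = i)
  have : |x / δ - y / δ| < 3 := by rw [abs_lt]; constructor <;> linarith
  rw [← sub_div, abs_div, abs_of_pos hδ, div_lt_iff₀ hδ] at this
  exact this

lemma Nb_disj {N : ℕ} {δ R : ℝ} (hδ : 0 < δ) (hN : 2 * R / δ + 10 < N) {A B : Set (ℝ × ℝ)}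
    (hA : ∀ p ∈ A, |p.1| ≤ R ∧ |p.2| ≤ R) (hB : ∀ p ∈ B, |p.1| ≤ R ∧ |p.2| ≤ R)
    (hAB : ∀ p ∈ A, ∀ q ∈ B, 3 * δ ≤ dist p q) (x : Pt N) (hx : x ∈ Nb N δ A)
    (hx' : x ∈ Nb N δ B) : False := by
  obtain ⟨p, hp, a, ha1, ha2, rfl⟩ := hx
  obtain ⟨q, hq, b, hb1, hb2, hab⟩ := hx'
  have h1 := congrArg Prod.fst hab
  have h2 := congrArg Prod.snd hab
  have := hAB p hp q hq
  rw [Prod.dist_eq] at this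
  have c1 := coord_close hδ (hA p hp).1 (hB q hq).1 hN ha1 hb1 h1.symm
  have c2 := coord_close hδ (hA p hp).2 (hB q hq).2 hN ha2 hb2 h2.symm
  exact absurd this (not_le.2 (max_lt c1 c2))

lemma exists_sep {I : Type*} [Finite I] (S : I → Set (ℝ × ℝ)) (hS : ∀ i, IsCompact (S i)) :
    ∃ ε > 0, ∀ i j, Disjoint (S i) (S j) → ∀ p ∈ S i, ∀ q ∈ S j, ε ≤ dist p q := by
  have h : ∀ ij : I × I, ∀ᶠ ε in nhdsWithin (0 : ℝ) (Set.Ioi 0),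
      Disjoint (S ij.1) (S ij.2) → ∀ p ∈ S ij.1, ∀ q ∈ S ij.2, ε ≤ dist p q := by
    rintro ⟨i, j⟩
    by_cases hd : Disjoint (S i) (S j)
    · obtain ⟨r, hr, h⟩ := Metric.exists_pos_forall_lt_edist (hS i) (hS j).isClosed hd
      filter_upwards [Ioo_mem_nhdsGT (show (0 : ℝ) < r from hr)] with ε hε _ p hp q hq
      have := h p hp q hq
      rw [edist_nndist] at this
      have : (r : ℝ) < dist p q := by exact_mod_cast this
      exact hε.2.le.trans this.le
    · exact Filter.Eventually.of_forall (fun _ h => absurd h hd)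
  have h2 := (Filter.eventually_all.2 h).and self_mem_nhdsWithin
  obtain ⟨ε, hε, hpos⟩ := h2.exists
  exact ⟨ε, hpos, fun i j => hε (i, j)⟩

/-- Abstract system of connected compact sets realising the graph in the plane. -/
theorem plane_bound {V E : Type*} [Fintype V] [Fintype E] [Nonempty V]
    (s t : E → V) (c : V → Bool)
    (hs : ∀ e, c (s e) = true) (ht : ∀ e, c (t e) = false)
    (hinj : ∀ e e', s e = s e' → t e = t e' → e = e')
    (A : V → Set (ℝ × ℝ)) (L : E → Set (ℝ × ℝ))
    (hne : ∀ v, (A v).Nonempty)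
    (hAk : ∀ v, IsCompact (A v)) (hLk : ∀ e, IsCompact (L e))
    (hAc : ∀ v, IsPreconnected (A v)) (hLc : ∀ e, IsPreconnected (L e))
    (hAd : ∀ u v, u ≠ v → Disjoint (A u) (A v))
    (hLs : ∀ e, (L e ∩ A (s e)).Nonempty)
    (hLt : ∀ e, (L e ∩ A (t e)).Nonempty)
    (hLA : ∀ e v, v ≠ s e → v ≠ t e → Disjoint (L e) (A v))
    (hLL : ∀ e e', e ≠ e' → Disjoint (L e) (L e')) :
    Fintype.card E ≤ 2 * Fintype.card V := by
  let S : V ⊕ E → Set (ℝ × ℝ) := Sum.elim A L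
  have hS : ∀ i, IsCompact (S i) := by rintro (v | e); exacts [hAk v, hLk e]
  obtain ⟨ε, hε, hsep⟩ := exists_sep S hS
  obtain ⟨R, hR⟩ := (isCompact_iUnion hS).isBounded.exists_norm_le
  have hR' : ∀ i, ∀ p ∈ S i, |p.1| ≤ R ∧ |p.2| ≤ R := by
    intro i p hp
    have := hR p (Set.mem_iUnion.2 ⟨i, hp⟩)
    rw [Prod.norm_def, max_le_iff] at this
    exact this
  set δ := ε / 3 with hδdef
  have hδ : 0 < δ := by positivity
  obtain ⟨N₀, hN₀⟩ := exists_nat_gt (2 * R / δ + 10)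
  have hN : 2 * R / δ + 10 < ((N₀ + 1 : ℕ) : ℝ) := by push_cast; linarith
  have hdisj : ∀ i j, Disjoint (S i) (S j) → ∀ x, x ∈ Nb (N₀ + 1) δ (S i) →
      x ∈ Nb (N₀ + 1) δ (S j) → False := by
    intro i j hd x hx hx'
    refine Nb_disj hδ hN (hR' i) (hR' j) ?_ x hx hx'
    intro p hp q hq
    have := hsep i j hd p hp q hq
    rw [hδdef]; linarith
  have hmem : ∀ (A : Set (ℝ × ℝ)) p, p ∈ A → red (N₀ + 1) (fl δ p) ∈ Nb (N₀ + 1) δ A :=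
    fun A p hp => ⟨p, hp, fl δ p, by simp, by simp, rfl⟩
  refine minor_bound (N := N₀ + 1) s t c hs ht hinj (fun v => Nb _ δ (A v)) (fun e => Nb _ δ (L e))
    ?_ ?_ (fun v => Nb_conn _ hδ _ (hAc v)) (fun e => Nb_conn _ hδ _ (hLc e)) ?_ ?_ ?_ ?_
  · intro v
    obtain ⟨p, hp⟩ := hne v
    exact ⟨_, hmem _ p hp⟩
  · intro u v x hu hv
    by_contra h
    exact hdisj (.inl u) (.inl v) (hAd u v h) x hu hv
  · intro e
    obtain ⟨p, hp, hp'⟩ := hLs e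
    exact ⟨_, hmem _ p hp, hmem _ p hp'⟩
  · intro e
    obtain ⟨p, hp, hp'⟩ := hLt e
    exact ⟨_, hmem _ p hp, hmem _ p hp'⟩
  · intro e v x hx hx'
    by_contra! h
    exact hdisj (.inr e) (.inl v) (hLA e v h.1 h.2) x hx hx'
  · intro e e' x hx hx'
    by_contra h
    exact hdisj (.inr e) (.inr e') (hLL e e' h) x hx hx'

end TorusGrid
namespace TorusGrid

/-- Branch set of the vertex `v` in a drawing. -/
def branch {V E : Type*} (s t : E → V) (pt : V → ℝ × ℝ) (γ : E → ℝ → ℝ × ℝ) (v : V) :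
    Set (ℝ × ℝ) :=
  {pt v} ∪ ((⋃ e : {e // s e = v}, γ e.1 '' Set.Icc 0 (1/2)) ∪
    ⋃ e : {e // t e = v}, γ e.1 '' Set.Icc (2/3) 1)

theorem drawing_bound {V E : Type*} [Fintype V] [Fintype E] [Nonempty V]
    (s t : E → V) (c : V → Bool)
    (hs : ∀ e, c (s e) = true) (ht : ∀ e, c (t e) = false)
    (hinj : ∀ e e', s e = s e' → t e = t e' → e = e')
    (pt : V → ℝ × ℝ) (hpt : Function.Injective pt) (γ : E → ℝ → ℝ × ℝ)
    (hγ : ∀ e, Continuous (γ e)) (hγi : ∀ e, Set.InjOn (γ e) (Set.Icc 0 1))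
    (h0 : ∀ e, γ e 0 = pt (s e)) (h1 : ∀ e, γ e 1 = pt (t e))
    (hv : ∀ e v, ∀ x ∈ Set.Icc (0 : ℝ) 1, γ e x = pt v → v = s e ∨ v = t e)
    (hd : ∀ e e', e ≠ e' → ∀ x ∈ Set.Icc (0 : ℝ) 1, ∀ y ∈ Set.Icc (0 : ℝ) 1,
      γ e x = γ e' y → ∃ w, γ e x = pt w) :
    Fintype.card E ≤ 2 * Fintype.card V := by
  have i0 : (0 : ℝ) ∈ Set.Icc (0 : ℝ) 1 := by simp
  have i1 : (1 : ℝ) ∈ Set.Icc (0 : ℝ) 1 := by simp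
  -- parameters of vertices on an arc
  have hpar : ∀ e v, ∀ x ∈ Set.Icc (0 : ℝ) 1, γ e x = pt v →
      (v = s e ∧ x = 0) ∨ (v = t e ∧ x = 1) := by
    intro e v x hx h
    rcases hv e v x hx h with rfl | rfl
    · exact Or.inl ⟨rfl, hγi e hx i0 (h.trans (h0 e).symm)⟩
    · exact Or.inr ⟨rfl, hγi e hx i1 (h.trans (h1 e).symm)⟩
  have hcases : ∀ v z, z ∈ branch s t pt γ v → z = pt v ∨
      (∃ e x, x ∈ Set.Icc (0 : ℝ) 1 ∧ γ e x = z ∧ ((s e = v ∧ x ≤ 1/2) ∨ (t e = v ∧ 2/3 ≤ x))) := by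
    rintro v z (hz | hz | hz)
    · exact Or.inl hz
    · obtain ⟨⟨e, he⟩, x, hx, rfl⟩ := Set.mem_iUnion.1 hz
      exact Or.inr ⟨e, x, ⟨hx.1, by linarith [hx.2]⟩, rfl, Or.inl ⟨he, hx.2⟩⟩
    · obtain ⟨⟨e, he⟩, x, hx, rfl⟩ := Set.mem_iUnion.1 hz
      exact Or.inr ⟨e, x, ⟨by linarith [hx.1], hx.2⟩, rfl, Or.inr ⟨he, hx.1⟩⟩
  have hbv : ∀ v w, pt w ∈ branch s t pt γ v → w = v := by
    intro v w hw
    rcases hcases v _ hw with h | ⟨e, x, hx, h, h'⟩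
    · exact hpt h
    · rcases hpar e w x hx h with ⟨rfl, rfl⟩ | ⟨rfl, rfl⟩
      · rcases h' with ⟨h', _⟩ | ⟨_, h'⟩
        · exact h'
        · norm_num at h'
      · rcases h' with ⟨_, h'⟩ | ⟨h', _⟩
        · norm_num at h'
        · exact h'
  have hmid : ∀ e, ∀ x ∈ Set.Icc (1/2 : ℝ) (2/3), ∀ w, γ e x ≠ pt w := by
    intro e x hx w h
    rcases hpar e w x ⟨by linarith [hx.1], by linarith [hx.2]⟩ h with ⟨_, rfl⟩ | ⟨_, rfl⟩
    · have := hx.1; norm_num at this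
    · have := hx.2; norm_num at this
  have hsub : ∀ x ∈ Set.Icc (1/2 : ℝ) (2/3), x ∈ Set.Icc (0 : ℝ) 1 :=
    fun x hx => ⟨by linarith [hx.1], by linarith [hx.2]⟩
  refine plane_bound s t c hs ht hinj (branch s t pt γ) (fun e => γ e '' Set.Icc (1/2) (2/3))
    (fun v => ⟨pt v, Or.inl rfl⟩) ?_ (fun e => isCompact_Icc.image (hγ e)) ?_
    (fun e => isPreconnected_Icc.image _ (hγ e).continuousOn) ?_ ?_ ?_ ?_ ?_
  · intro v
    exact isCompact_singleton.union
      ((isCompact_iUnion fun e => isCompact_Icc.image (hγ _)).union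
      (isCompact_iUnion fun e => isCompact_Icc.image (hγ _)))
  · intro v
    refine isPreconnected_of_forall (pt v) ?_
    rintro z (hz | hz | hz)
    · exact ⟨{pt v}, Set.subset_union_left, rfl, hz, isPreconnected_singleton⟩
    · obtain ⟨e, hz⟩ := Set.mem_iUnion.1 hz
      refine ⟨_, ?_, ?_, hz, isPreconnected_Icc.image _ (hγ _).continuousOn⟩
      · exact fun y hy => Or.inr (Or.inl (Set.mem_iUnion.2 ⟨e, hy⟩))
      · exact ⟨0, by norm_num, by rw [h0, e.2]⟩
    · obtain ⟨e, hz⟩ := Set.mem_iUnion.1 hz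
      refine ⟨_, ?_, ?_, hz, isPreconnected_Icc.image _ (hγ _).continuousOn⟩
      · exact fun y hy => Or.inr (Or.inr (Set.mem_iUnion.2 ⟨e, hy⟩))
      · exact ⟨1, by norm_num, by rw [h1, e.2]⟩
  · intro u v huv
    rw [Set.disjoint_left]
    intro z hzu hzv
    have hno : ∀ w, z ≠ pt w := by
      rintro w rfl
      exact huv ((hbv u w hzu).symm.trans (hbv v w hzv))
    rcases hcases u z hzu with h | ⟨e, x, hx, h, h'⟩
    · exact hno _ h
    rcases hcases v z hzv with k | ⟨e', y, hy, k, k'⟩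
    · exact hno _ k
    by_cases hee : e = e'
    · subst hee
      have hxy := hγi e hx hy (h.trans k.symm)
      subst hxy
      rcases h' with ⟨a, b⟩ | ⟨a, b⟩ <;> rcases k' with ⟨a', b'⟩ | ⟨a', b'⟩
      · exact huv (a.symm.trans a')
      · linarith
      · linarith
      · exact huv (a.symm.trans a')
    · obtain ⟨w, hw⟩ := hd e e' hee x hx y hy (h.trans k.symm)
      exact hno w (h.symm.trans hw)
  · intro e
    refine ⟨γ e (1/2), ⟨1/2, by norm_num, rfl⟩, Or.inr (Or.inl (Set.mem_iUnion.2 ⟨⟨e, rfl⟩, ?_⟩))⟩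
    exact ⟨1/2, by norm_num, rfl⟩
  · intro e
    refine ⟨γ e (2/3), ⟨2/3, by norm_num, rfl⟩, Or.inr (Or.inr (Set.mem_iUnion.2 ⟨⟨e, rfl⟩, ?_⟩))⟩
    exact ⟨2/3, by norm_num, rfl⟩
  · intro e v hvs hvt
    rw [Set.disjoint_left]
    rintro z ⟨x, hx, rfl⟩ hzv
    rcases hcases v _ hzv with h | ⟨e', y, hy, h, h'⟩
    · exact hmid e x hx _ h
    by_cases hee : e' = e
    · subst hee
      rcases h' with ⟨a, _⟩ | ⟨a, _⟩
      · exact hvs a.symm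
      · exact hvt a.symm
    · obtain ⟨w, hw⟩ := hd e' e hee y hy x (hsub x hx) h
      exact hmid e x hx w (h.symm.trans hw)
  · intro e e' hee
    rw [Set.disjoint_left]
    rintro z ⟨x, hx, rfl⟩ ⟨y, hy, hxy⟩
    obtain ⟨w, hw⟩ := hd e e' hee x (hsub x hx) y (hsub y hy) hxy.symm
    exact hmid e x hx w hw

end TorusGrid

/-- Directed edges, from the `true` side to the `false` side. -/
abbrev BEdge {V : Type*} (G : SimpleGraph V) (c : V → Bool) :=
  {p : V × V // G.Adj p.1 p.2 ∧ c p.1 = true ∧ c p.2 = false}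

open Classical in
theorem edge_subset_bound {V : Type*} [Fintype V] (G : SimpleGraph V) (c : V → Bool)
    (D : PlaneDrawing G) (A : Finset (BEdge G c)) :
    A.card ≤ 2 * (A.biUnion (fun e => {e.1.1, e.1.2})).card := by
  rcases A.eq_empty_or_nonempty with rfl | ⟨e₀, he₀⟩
  · simp
  set W : Finset V := A.biUnion (fun e => {e.1.1, e.1.2}) with hW
  have hmem : ∀ e ∈ A, e.1.1 ∈ W ∧ e.1.2 ∈ W := by
    intro e he
    simp only [hW, Finset.mem_biUnion]
    exact ⟨⟨e, he, by simp⟩, ⟨e, he, by simp⟩⟩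
  have : Nonempty W := ⟨⟨_, (hmem e₀ he₀).1⟩⟩
  have hrange : ∀ (e : A) (x : ℝ), (D.arc e.1.2.1).extend x ∈ Set.range (D.arc e.1.2.1) := by
    intro e x
    rw [← Path.extend_range]; exact ⟨x, rfl⟩
  have key := TorusGrid.drawing_bound (V := W) (E := A)
    (fun e => ⟨e.1.1.1, (hmem e.1 e.2).1⟩) (fun e => ⟨e.1.1.2, (hmem e.1 e.2).2⟩)
    (fun v => c v.1) (fun e => e.1.2.2.1) (fun e => e.1.2.2.2) ?_ (fun v => D.vert v.1)
    (fun u v h => Subtype.ext (D.vert_inj h)) (fun e => (D.arc e.1.2.1).extend)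
    (fun e => Path.continuous_extend _) ?_ (fun e => Path.extend_zero _) (fun e => Path.extend_one _)
    ?_ ?_
  · simpa using key
  · intro e e' h h'
    simp only [Subtype.mk.injEq] at h h'
    exact Subtype.ext (Subtype.ext (Prod.ext h h'))
  · intro e x hx y hy hxy
    simp only [Path.extend_apply _ hx, Path.extend_apply _ hy] at hxy
    exact congrArg Subtype.val (D.arc_inj _ hxy)
  · intro e v x hx h
    have := D.arc_vert e.1.2.1 v.1 (h ▸ hrange e x)
    rcases this with h | h
    · exact Or.inl (Subtype.ext h)
    · exact Or.inr (Subtype.ext h)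
  · intro e e' hee x hx y hy h
    have hne : s(e.1.1.1, e.1.1.2) ≠ s(e'.1.1.1, e'.1.1.2) := by
      intro hs
      rw [Sym2.eq_iff] at hs
      rcases hs with ⟨a, b⟩ | ⟨a, b⟩
      · exact hee (Subtype.ext (Subtype.ext (Prod.ext a b)))
      · have h1 := e.1.2.2.1
        rw [a, e'.1.2.2.2] at h1
        cases h1
    have hx' := hrange e x
    have hy' := hrange e' y
    rw [← h] at hy'
    have := (D.arc_disjoint e.1.2.1 e'.1.2.1 hne ⟨hx', hy'⟩).1
    rcases this with h | h
    · exact ⟨⟨_, (hmem e.1 e.2).1⟩, h⟩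
    · exact ⟨⟨_, (hmem e.1 e.2).2⟩, h⟩

open Classical in
theorem exists_heads {V : Type*} [Fintype V] (G : SimpleGraph V) (c : V → Bool)
    (D : PlaneDrawing G) :
    ∃ f : BEdge G c → V × Fin 2, Function.Injective f ∧
      ∀ e, (f e).1 = e.1.1 ∨ (f e).1 = e.1.2 := by
  obtain ⟨f, hf, hf'⟩ := (Finset.all_card_le_biUnion_card_iff_exists_injective
    (fun e : BEdge G c => (({e.1.1, e.1.2} : Finset V) ×ˢ (Finset.univ : Finset (Fin 2))))).1 (by
      intro A
      have h := edge_subset_bound G c D A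
      have : A.biUnion (fun e : BEdge G c =>
          (({e.1.1, e.1.2} : Finset V) ×ˢ (Finset.univ : Finset (Fin 2)))) =
          (A.biUnion (fun e => {e.1.1, e.1.2})) ×ˢ (Finset.univ : Finset (Fin 2)) := by
        ext x; simp
      rw [this, Finset.card_product]
      simp only [Finset.card_univ, Fintype.card_fin]
      omega)
  refine ⟨f, hf, fun e => ?_⟩
  have := hf' e
  simpa using this

open Classical in
theorem three_le_degree {V : Type*} [Fintype V] (G : SimpleGraph V) (h : ThreeConnected G) (v : V) :
    3 ≤ (G.neighborFinset v).card := by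
  by_contra! hlt
  have hc := h.2 (G.neighborFinset v : Set V) (by rw [Set.ncard_coe_finset]; omega)
  obtain ⟨w, hw⟩ : ∃ w, w ∉ insert v (G.neighborFinset v) := by
    by_contra! hall
    have h1 : (Finset.univ : Finset V) ⊆ insert v (G.neighborFinset v) := fun x _ => hall x
    have h2 := Finset.card_le_card h1
    have h3 := Finset.card_insert_le v (G.neighborFinset v)
    have := h.1
    rw [Finset.card_univ] at h2
    omega
  simp only [Finset.mem_insert, SimpleGraph.mem_neighborFinset, not_or] at hw
  set H := (⊤ : G.Subgraph).deleteVerts (G.neighborFinset v : Set V) with hH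
  have hv : v ∈ H.verts := by simp [hH]
  have hw' : w ∈ H.verts := by simp [hH, hw.2]
  obtain ⟨p⟩ := hc.preconnected ⟨v, hv⟩ ⟨w, hw'⟩
  cases p with
  | nil => exact hw.1 rfl
  | cons hadj q =>
    rename_i y
    have h1 := hadj
    rw [SimpleGraph.Subgraph.coe_adj] at h1
    have h2 := y.2
    have h3 := h1.adj_sub
    simp [hH] at h2
    exact h2 h3

/-- Every 3-connected simple bipartite planar graph has a proper orientation
with all indegrees at most `3`. -/
theorem three_connected_bipartite_planar {V : Type*} [Fintype V]
    (G : SimpleGraph V) (hbip : IsBipartite G) (hpl : IsPlanar G)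
    (h3c : ThreeConnected G) :
    ∃ o : V → V → Prop, IsOrientation G o ∧ IsProper G o ∧
      ∀ v, inDeg o v ≤ 3 := by
  classical
  obtain ⟨c, hc⟩ := hbip
  obtain ⟨D⟩ := hpl
  obtain ⟨f, hf, hf'⟩ := exists_heads G c D
  -- heads at `a`
  let T : V → Finset V := fun a => Finset.univ.filter
    (fun b => ∃ h : G.Adj a b ∧ c a = true ∧ c b = false, (f ⟨(a, b), h⟩).1 = a)
  have hT : ∀ a, ∃ S : Finset V, T a ⊆ S ∧ S ⊆ G.neighborFinset a ∧ S.card = 3 := by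
    intro a
    apply Finset.exists_subsuperset_card_eq
    · intro b hb
      simp only [T, Finset.mem_filter] at hb
      obtain ⟨_, h, _⟩ := hb
      simpa using h.1
    · have : (T a).card ≤ (Finset.univ : Finset (Fin 2)).card := by
        refine Finset.card_le_card_of_injOn
          (fun b => if h : G.Adj a b ∧ c a = true ∧ c b = false then (f ⟨(a, b), h⟩).2 else 0)
          (fun _ _ => Finset.mem_coe.2 (Finset.mem_univ _)) ?_
        intro b hb b' hb' hbb
        simp only [T, Finset.coe_filter, Finset.mem_univ, true_and, Set.mem_ofPred_eq] at hb hb'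
        obtain ⟨h, h1⟩ := hb
        obtain ⟨h', h1'⟩ := hb'
        simp only [dif_pos h, dif_pos h'] at hbb
        have := hf (Prod.ext (h1.trans h1'.symm) hbb)
        simpa using this
      simp at this
      omega
    · exact three_le_degree G h3c a
  choose S hTS hSN hS3 using hT
  let o : V → V → Prop := fun u v => G.Adj u v ∧ if c v = true then u ∈ S v else v ∉ S u
  have htrue : ∀ v, c v = true → inDeg o v = 3 := by
    intro v hv
    have : {u | o u v} = (S v : Set V) := by
      ext u
      simp only [o, hv, if_true, Set.mem_ofPred_eq, Finset.mem_coe]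
      refine ⟨fun h => h.2, fun h => ⟨?_, h⟩⟩
      have := hSN v h
      rw [SimpleGraph.mem_neighborFinset] at this
      exact this.symm
    rw [inDeg, this, Set.ncard_coe_finset, hS3]
  have hfalse : ∀ v, c v = false → inDeg o v ≤ 2 := by
    intro v hv
    have hout : ∀ u, o u v → ∃ h : G.Adj u v ∧ c u = true ∧ c v = false,
        (f ⟨(u, v), h⟩).1 = v := by
      intro u hu
      have hcu : c u = true := by
        have := hc u v hu.1
        rw [hv] at this
        simpa using this
      have hu2 := hu.2
      simp only [hv, Bool.false_eq_true, if_false] at hu2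
      refine ⟨⟨hu.1, hcu, hv⟩, ?_⟩
      rcases hf' ⟨(u, v), ⟨hu.1, hcu, hv⟩⟩ with h | h
      · exact absurd (hTS u (by simp only [T, Finset.mem_filter]; exact ⟨Finset.mem_univ _, _, h⟩)) hu2
      · exact h
    rw [inDeg, Set.ncard_eq_toFinset_card']
    have : ({u | o u v}.toFinset).card ≤ (Finset.univ : Finset (Fin 2)).card := by
      refine Finset.card_le_card_of_injOn
        (fun u => if h : G.Adj u v ∧ c u = true ∧ c v = false then (f ⟨(u, v), h⟩).2 else 0)
        (fun _ _ => Finset.mem_coe.2 (Finset.mem_univ _)) ?_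
      intro u hu u' hu' huu
      simp only [Set.coe_toFinset, Set.mem_ofPred_eq] at hu hu'
      obtain ⟨h, h1⟩ := hout u hu
      obtain ⟨h', h1'⟩ := hout u' hu'
      simp only [dif_pos h, dif_pos h'] at huu
      have := hf (Prod.ext (h1.trans h1'.symm) huu)
      simpa using this
    simpa using this
  refine ⟨o, ⟨?_, ?_⟩, ?_, ?_⟩
  · intro u v
    constructor
    · intro h
      have hne := hc u v h
      simp only [o, h, h.symm, true_and]
      cases hu : c u <;> cases hv : c v <;> simp_all <;> tauto
    · rintro (h | h)
      · exact h.1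
      · exact h.1.symm
  · rintro u v ⟨h, h1⟩ ⟨_, h2⟩
    have hne := hc u v h
    cases hu : c u <;> cases hv : c v <;> simp_all
  · intro u v h
    have hne := hc u v h
    cases hu : c u <;> cases hv : c v
    · simp_all
    · have := hfalse u hu; have := htrue v hv; omega
    · have := hfalse v hv; have := htrue u hu; omega
    · simp_all
  · intro v
    cases hv : c v
    · have := hfalse v hv; omega
    · exact (htrue v hv).le
end
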